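/- Let 𝒯 be a family of trajectories of ẋ = f(t,x,σ(t)) invariant w.r.t. a closed covering χ = {χ_i}_{i∈I} of ℝ^n. Suppose there exists V : ℝ≥0 × 𝒳 × I → ℝ≥0 such that: (i) there are φ₁, φ₂ ∈ 𝒦 with φ₁(|ξ|) ≤ V(t,ξ,i) ≤ φ₂(|ξ|) for all t ≥ 0, all ξ ∈ χ_i ∩ 𝒳 and all i; (ii) each V_i := V(·,·,i) is continuously differentiable and ∂V_i/∂t(t,ξ) + ∂V_i/∂ξ(t,ξ)·f_i(t,ξ) ≤ −η_i(t,ξ) for all t ≥ 0, ξ ∈ χ_i ∩ 𝒳, i ∈ I, where η_i : ℝ≥0 × 𝒳 → ℝ≥0 is measurable in t and continuous in ξ; (iii) for every (x,σ) ∈ 𝒯 and t₀(x) ≤ t < s < t_f(x) with σ(t) = σ(s) = i, V_i(t,x(t)) ≥ V_i(s,x(s)). Define the output h(t,ξ,i) := η_i(t,ξ), and suppose f and h satisfy: each f_i uniformly bounded; each h_i uniformly bounded, measurable in t, continuous in ξ uniformly in t, precompact; f_i = f̂_i + Δf_i with f̂_i uniformly bounded, measurable in t, continuous in ξ uniformly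 in t, precompact and (h_i, Δf_i) a zeroing pair. Then 𝒯 is UAS provided every reduced limiting control system Σ_γ for 𝒯 is WZSD. If, in addition, 𝒳 = ℝ^n and φ₁, φ₂ ∈ 𝒦∞, then 𝒯 is GUAS. -/

import Mathlib

open MeasureTheory Filter Set Topology

noncomputable section

namespace SwitchedSys

/-- Euclidean state space ℝⁿ. -/
abbrev E (n : ℕ) := EuclideanSpace ℝ (Fin n)

/-! ### Comparison function classes -/

/-- Class 𝒦 functions (on [0,∞)). -/
def ClassK (α : ℝ → ℝ) : Prop :=
  ContinuousOn α (Ici 0) ∧ StrictMonoOn α (Ici 0) ∧ α 0 = 0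

/-- Class 𝒦∞ functions. -/
def ClassKInf (α : ℝ → ℝ) : Prop :=
  ClassK α ∧ Tendsto α atTop atTop

/-- Class 𝒦ℒ functions. -/
def ClassKL (β : ℝ → ℝ → ℝ) : Prop :=
  (∀ t, 0 ≤ t → ClassKInf fun r => β r t) ∧
  ∀ r, 0 ≤ r → AntitoneOn (fun t => β r t) (Ici 0) ∧
    Tendsto (fun t => β r t) atTop (nhds 0)

/-! ### Switching signals, controls and weak convergence -/

/-- A switching signal: piecewise constant and continuous from the right, with at most
finitely many jumps in each compact interval. -/
def IsSwitchingSignal {N : ℕ} (σ : ℝ → Fin N) : Prop :=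
  ∀ a b : ℝ, a < b → ∃ (k : ℕ) (τ : ℕ → ℝ), τ 0 = a ∧ τ k = b ∧
    (∀ j, j < k → τ j < τ (j + 1)) ∧
    ∀ j, j < k → ∀ s ∈ Ico (τ j) (τ (j + 1)), σ s = σ (τ j)

/-- The standard simplex U ⊆ ℝᴺ. -/
def simplexU (N : ℕ) : Set (Fin N → ℝ) := {μ | (∀ i, 0 ≤ μ i) ∧ ∑ i, μ i = 1}

/-- The set 𝒰 of admissible controls: measurable functions with values in the simplex. -/
def IsControl {N : ℕ} (u : ℝ → Fin N → ℝ) : Prop :=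
  Measurable u ∧ ∀ t, u t ∈ simplexU N

/-- The i-th canonical basis vector of ℝᴺ. -/
def stdVec (N : ℕ) (i : Fin N) : Fin N → ℝ := fun j => if j = i then 1 else 0

/-- The control u_σ = e_{σ(·)} associated with a switching signal σ. -/
def ctrlOfSwitch {N : ℕ} (σ : ℝ → Fin N) : ℝ → Fin N → ℝ := fun t => stdVec N (σ t)

/-- Weak convergence u_k ⇀ v, tested against all f ∈ L¹(ℝ,ℝᴺ). -/
def WeakConv {N : ℕ} (u : ℕ → ℝ → Fin N → ℝ) (v : ℝ → Fin N → ℝ) : Prop :=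
  ∀ g : ℝ → Fin N → ℝ, Integrable g volume →
    Tendsto (fun k => ∫ t : ℝ, ∑ i, g t i * u k t i)
      atTop (nhds (∫ t : ℝ, ∑ i, g t i * v t i))

/-! ### Regularity notions for time-varying maps -/

/-- g(t,ξ) is uniformly bounded: bounded on J′ × K for each compact K ⊆ 𝒳,
where J′ ⊆ [0,∞) has full measure. -/
def UnifBounded {X F : Type*} [TopologicalSpace X] [NormedAddCommGroup F]
    (𝒳 : Set X) (g : ℝ → X → F) : Prop :=
  ∃ J' ⊆ Ici (0:ℝ), volume (Ici (0:ℝ) \ J') = 0 ∧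
    ∀ K : Set X, IsCompact K → K ⊆ 𝒳 → ∃ C : ℝ, ∀ t ∈ J', ∀ ξ ∈ K, ‖g t ξ‖ ≤ C

/-- g(t,ξ) is continuous in ξ uniformly in t (via a class 𝒦 modulus of continuity on
each compact subset of 𝒳). -/
def ContXiUnifT {X F : Type*} [NormedAddCommGroup X] [NormedAddCommGroup F]
    (𝒳 : Set X) (g : ℝ → X → F) : Prop :=
  ∃ J' ⊆ Ici (0:ℝ), volume (Ici (0:ℝ) \ J') = 0 ∧
    ∀ K : Set X, IsCompact K → K ⊆ 𝒳 → ∃ ω : ℝ → ℝ, ClassK ω ∧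
      ∀ t ∈ J', ∀ ξ ∈ K, ∀ ζ ∈ K, ‖g t ξ - g t ζ‖ ≤ ω ‖ξ - ζ‖

/-- g(t,ξ) is locally Lipschitz in ξ uniformly in t. -/
def LipXiUnifT {X F : Type*} [NormedAddCommGroup X] [NormedAddCommGroup F]
    (𝒳 : Set X) (g : ℝ → X → F) : Prop :=
  ∃ J' ⊆ Ici (0:ℝ), volume (Ici (0:ℝ) \ J') = 0 ∧
    ∀ K : Set X, IsCompact K → K ⊆ 𝒳 → ∃ L : ℝ, 0 ≤ L ∧
      ∀ t ∈ J', ∀ ξ ∈ K, ∀ ζ ∈ K, ‖g t ξ - g t ζ‖ ≤ L * ‖ξ - ζ‖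

/-- gγ is the limiting function of g along the sequence γ = {t_k}: g(t_k+s,ξ) → gγ(s,ξ)
for all ξ ∈ 𝒳 and all s outside a Lebesgue-null set. -/
def IsLimitAlong {X F : Type*} [TopologicalSpace F]
    (𝒳 : Set X) (g : ℝ → X → F) (γ : ℕ → ℝ) (glim : ℝ → X → F) : Prop :=
  ∃ Eγ : Set ℝ, volume Eγ = 0 ∧ ∀ ξ ∈ 𝒳, ∀ s : ℝ, s ∉ Eγ →
    Tendsto (fun k => g (γ k + s) ξ) atTop (nhds (glim s ξ))

/-- γ is an admissible sequence for g. -/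
def Admissible {X F : Type*} [TopologicalSpace F]
    (𝒳 : Set X) (g : ℝ → X → F) (γ : ℕ → ℝ) : Prop :=
  Tendsto γ atTop atTop ∧ ∃ glim : ℝ → X → F, IsLimitAlong 𝒳 g γ glim

/-- g is precompact: every sequence t_k → ∞ has an admissible subsequence. -/
def Precompact {X F : Type*} [TopologicalSpace F]
    (𝒳 : Set X) (g : ℝ → X → F) : Prop :=
  ∀ t : ℕ → ℝ, Tendsto t atTop atTop →
    ∃ φ : ℕ → ℕ, StrictMono φ ∧ Admissible 𝒳 g (t ∘ φ)

/-- (g, gh) is a zeroing pair. -/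
def ZeroingPair {X F G : Type*} [NormedAddCommGroup X] [NormedAddCommGroup F]
    [NormedAddCommGroup G] (𝒳 : Set X) (g : ℝ → X → F) (gh : ℝ → X → G) : Prop :=
  ∀ t : ℕ → ℝ, Tendsto t atTop atTop → ∀ K : Set X, IsCompact K → K ⊆ 𝒳 →
    ∀ ε : ℝ, 0 < ε → ∀ v : ℕ → X, (∀ k, v k ∈ K) → (∀ k, ε ≤ ‖v k‖) →
      Tendsto (fun k => g (t k) (v k)) atTop (nhds 0) →
      Tendsto (fun k => gh (t k) (v k)) atTop (nhds 0)

/-- Carathéodory conditions for a time-varying vector field on 𝒳. -/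
def Caratheodory {n : ℕ} (𝒳 : Set (E n)) (g : ℝ → E n → E n) : Prop :=
  (∀ ξ ∈ 𝒳, Measurable fun t => g t ξ) ∧
  (∀ᵐ t ∂volume.restrict (Ici (0:ℝ)), ContinuousOn (fun ξ => g t ξ) 𝒳) ∧
  ∀ K : Set (E n), IsCompact K → K ⊆ 𝒳 →
    ∃ m : ℝ → ℝ, (∀ a b : ℝ, IntervalIntegrable m volume a b) ∧
      ∀ᵐ t ∂volume.restrict (Ici (0:ℝ)), ∀ ξ ∈ K, ‖g t ξ‖ ≤ m t

/-! ### Solutions and trajectories of the switched system -/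

/-- A (forward) solution of ẋ = f(t,x,σ(t)) on [t0, tf), encoded through the equivalent
integral equation (x is locally absolutely continuous with ẋ(t) = f(t,x(t),σ(t)) a.e.). -/
structure Sol {n N : ℕ} (𝒳 : Set (E n)) (f : ℝ → E n → Fin N → E n) where
  x : ℝ → E n
  σ : ℝ → Fin N
  t0 : ℝ
  tf : EReal
  t0_nonneg : 0 ≤ t0
  t0_lt_tf : (t0 : EReal) < tf
  switching : IsSwitchingSignal σ
  mem : ∀ t : ℝ, t0 ≤ t → (t : EReal) < tf → x t ∈ 𝒳
  intg : ∀ a b : ℝ, t0 ≤ a → a ≤ b → (b : EReal) < tf →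
    IntervalIntegrable (fun τ => f τ (x τ) (σ τ)) volume a b
  sol : ∀ a b : ℝ, t0 ≤ a → a ≤ b → (b : EReal) < tf →
    x b = x a + ∫ τ in a..b, f τ (x τ) (σ τ)

variable {n N : ℕ} {𝒳 : Set (E n)} {f : ℝ → E n → Fin N → E n}

/-- t belongs to the domain [t0, tf) of the solution. -/
def Sol.InDom (T : Sol 𝒳 f) (t : ℝ) : Prop := T.t0 ≤ t ∧ (t : EReal) < T.tf

/-- A solution is maximal if it admits no proper extension (a trajectory is a maximal
solution together with its switching signal). -/
def Sol.IsMaximal (T : Sol 𝒳 f) : Prop :=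
  ¬ ∃ T' : Sol 𝒳 f, T'.σ = T.σ ∧ T'.t0 = T.t0 ∧ T.tf < T'.tf ∧
    ∀ t : ℝ, T.InDom t → T'.x t = T.x t

/-! ### Stability notions -/

/-- Uniform stability of a family of trajectories. -/
def US (𝒯 : Set (Sol 𝒳 f)) : Prop :=
  ∃ α : ℝ → ℝ, ∃ δ₀ : ℝ, ClassK α ∧ 0 < δ₀ ∧
    ∀ T ∈ 𝒯, ∀ s : ℝ, T.InDom s → ‖T.x s‖ ≤ δ₀ →
      ∀ t : ℝ, s ≤ t → (t : EReal) < T.tf → ‖T.x t‖ ≤ α ‖T.x s‖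

/-- Global uniform stability of a family of trajectories. -/
def GUS (𝒯 : Set (Sol 𝒳 f)) : Prop :=
  𝒳 = Set.univ ∧ ∃ α : ℝ → ℝ, ClassKInf α ∧
    ∀ T ∈ 𝒯, ∀ s : ℝ, T.InDom s →
      ∀ t : ℝ, s ≤ t → (t : EReal) < T.tf → ‖T.x t‖ ≤ α ‖T.x s‖

/-- Uniform asymptotic stability of a family of trajectories. -/
def UAS (𝒯 : Set (Sol 𝒳 f)) : Prop :=
  ∃ β : ℝ → ℝ → ℝ, ∃ δ₀ : ℝ, ClassKL β ∧ 0 < δ₀ ∧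
    ∀ T ∈ 𝒯, ∀ s : ℝ, T.InDom s → ‖T.x s‖ < δ₀ →
      ∀ t : ℝ, s ≤ t → (t : EReal) < T.tf → ‖T.x t‖ ≤ β ‖T.x s‖ (t - s)

/-- Global uniform asymptotic stability of a family of trajectories. -/
def GUAS (𝒯 : Set (Sol 𝒳 f)) : Prop :=
  𝒳 = Set.univ ∧ ∃ β : ℝ → ℝ → ℝ, ClassKL β ∧
    ∀ T ∈ 𝒯, ∀ s : ℝ, T.InDom s →
      ∀ t : ℝ, s ≤ t → (t : EReal) < T.tf → ‖T.x t‖ ≤ β ‖T.x s‖ (t - s)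

/-! ### Output maps, zeroing-output sequences and WZSD -/

/-- A 𝒯-zeroing-output sequence for the switched system with output map h. -/
def ZeroingOutputSeq {F : Type*} [NormedAddCommGroup F]
    (𝒯 : Set (Sol 𝒳 f)) (h : ℝ → E n → Fin N → F)
    (t : ℕ → ℝ) (T : ℕ → Sol 𝒳 f) : Prop :=
  Tendsto t atTop atTop ∧ (∀ k, T k ∈ 𝒯) ∧
  (∀ k : ℕ, (T k).t0 ≤ t k - k ∧ ((t k + k : ℝ) : EReal) < (T k).tf) ∧
  (∃ K : Set (E n), IsCompact K ∧ K ⊆ 𝒳 ∧ ∃ ε : ℝ, 0 < ε ∧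
    ∀ k : ℕ, ∀ s : ℝ, |s| ≤ (k : ℝ) →
      (T k).x (t k + s) ∈ K ∧ ε ≤ ‖(T k).x (t k + s)‖) ∧
  ∀ᵐ s : ℝ, Tendsto (fun k => h (t k + s) ((T k).x (t k + s)) ((T k).σ (t k + s)))
    atTop (nhds 0)

/-- The pair (h,f) is weakly zero-state detectable with respect to 𝒯:
there is no 𝒯-zeroing-output sequence. -/
def WZSD {F : Type*} [NormedAddCommGroup F]
    (𝒯 : Set (Sol 𝒳 f)) (h : ℝ → E n → Fin N → F) : Prop :=
  ¬ ∃ (t : ℕ → ℝ) (T : ℕ → Sol 𝒳 f), ZeroingOutputSeq 𝒯 h t T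

/-- Assumption 1: integral bound for the output along trajectories of 𝒯. -/
def IntegralOutputBound {F : Type*} [NormedAddCommGroup F]
    (𝒯 : Set (Sol 𝒳 f)) (h : ℝ → E n → Fin N → F) : Prop :=
  ∃ α : ℝ → ℝ, ContinuousOn α (Ici 0) ∧ α 0 = 0 ∧ (∀ r : ℝ, 0 < r → 0 < α r) ∧
    ∀ K : Set (E n), IsCompact K → K ⊆ 𝒳 → ∀ μ : ℝ, 0 < μ → ∃ M : ℝ, 0 < M ∧
      ∀ T ∈ 𝒯, ∀ s t : ℝ, T.t0 ≤ s → s < t → (t : EReal) < T.tf →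
        (∀ τ ∈ Icc s t, T.x τ ∈ K) →
        ∫ τ in s..t, α ‖h τ (T.x τ) (T.σ τ)‖ ≤ M + μ * (t - s)

/-! ### Coverings, limiting trajectories and reduced limiting control systems -/

/-- The set U_ξ = co{e_i : ξ ∈ χ_i} of control values compatible with the covering χ at ξ. -/
def Uset {N n : ℕ} (χ : Fin N → Set (E n)) (ξ : E n) : Set (Fin N → ℝ) :=
  convexHull ℝ {v : Fin N → ℝ | ∃ i, ξ ∈ χ i ∧ v = stdVec N i}

/-- 𝒯 is invariant with respect to the covering χ: x(t) ∈ χ_{σ(t)} along trajectories. -/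
def InvariantWrt (𝒯 : Set (Sol 𝒳 f)) (χ : Fin N → Set (E n)) : Prop :=
  ∀ T ∈ 𝒯, ∀ t : ℝ, T.InDom t → T.x t ∈ χ (T.σ t)

/-- The set 𝒮*_𝒯 of controls that are weak limits of time-translations of switching
signals of trajectories in 𝒯. -/
def SStar (𝒯 : Set (Sol 𝒳 f)) (u : ℝ → Fin N → ℝ) : Prop :=
  IsControl u ∧ ∃ (t : ℕ → ℝ) (T : ℕ → Sol 𝒳 f),
    Tendsto t atTop atTop ∧ (∀ k, T k ∈ 𝒯) ∧
    WeakConv (fun k s => ctrlOfSwitch (T k).σ (t k + s)) u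

/-- Limiting trajectory of the family 𝒯. -/
def LimitingTrajectory (𝒯 : Set (Sol 𝒳 f)) (xb : ℝ → E n) (ub : ℝ → Fin N → ℝ) : Prop :=
  Continuous xb ∧ (∀ t, xb t ∈ 𝒳) ∧ IsControl ub ∧
  ∃ (t : ℕ → ℝ) (T : ℕ → Sol 𝒳 f) (K : Set (E n)),
    Tendsto t atTop atTop ∧ (∀ k, T k ∈ 𝒯) ∧ IsCompact K ∧ K ⊆ 𝒳 ∧
    (∀ k : ℕ, (T k).t0 ≤ t k - k ∧ ((t k + k : ℝ) : EReal) < (T k).tf) ∧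
    (∀ k : ℕ, ∀ s : ℝ, |s| ≤ (k : ℝ) → (T k).x (t k + s) ∈ K) ∧
    (∀ Tc : ℝ, 0 < Tc →
      TendstoUniformlyOn (fun k s => (T k).x (t k + s)) xb atTop (Icc (-Tc) Tc)) ∧
    WeakConv (fun k s => ctrlOfSwitch (T k).σ (t k + s)) ub

/-- 𝒯-zeroing-output limiting trajectory. -/
def ZeroingOutputLimitingTrajectory {F : Type*} [NormedAddCommGroup F]
    (𝒯 : Set (Sol 𝒳 f)) (h : ℝ → E n → Fin N → F)
    (xb : ℝ → E n) (ub : ℝ → Fin N → ℝ) : Prop :=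
  Continuous xb ∧ (∀ t, xb t ∈ 𝒳) ∧ IsControl ub ∧
  ∃ (t : ℕ → ℝ) (T : ℕ → Sol 𝒳 f), ZeroingOutputSeq 𝒯 h t T ∧
    (∀ Tc : ℝ, 0 < Tc →
      TendstoUniformlyOn (fun k s => (T k).x (t k + s)) xb atTop (Icc (-Tc) Tc)) ∧
    WeakConv (fun k s => ctrlOfSwitch (T k).σ (t k + s)) ub

/-- Locally absolutely continuous function on ℝ (indefinite integral of a locally
integrable function). -/
def LocAC {V : Type*} [NormedAddCommGroup V] [NormedSpace ℝ V] (x : ℝ → V) : Prop :=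
  ∃ g : ℝ → V, (∀ a b : ℝ, IntervalIntegrable g volume a b) ∧
    ∀ t : ℝ, x t = x 0 + ∫ s in (0:ℝ)..t, g s

/-- A complete trajectory of the reduced limiting control system Σ_γ determined by the
limiting functions fl = (f̂_{i,γ}) and hl = (h_{i,γ}), the covering χ and the constraint
u ∈ 𝒮*_𝒯: x is locally absolutely continuous and, for a.e. t, u(t) ∈ U_{x(t)},
x′(t) = Σ_i u_i(t) f̂_{i,γ}(t,x(t)) and Σ_i u_i(t) |h_{i,γ}(t,x(t))| = 0. -/
def CompleteTrajOf {F : Type*} [NormedAddCommGroup F]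
    (𝒯 : Set (Sol 𝒳 f)) (χ : Fin N → Set (E n))
    (fl : Fin N → ℝ → E n → E n) (hl : Fin N → ℝ → E n → F)
    (x : ℝ → E n) (u : ℝ → Fin N → ℝ) : Prop :=
  (∀ t, x t ∈ 𝒳) ∧ LocAC x ∧ SStar 𝒯 u ∧
  ∀ᵐ t : ℝ, u t ∈ Uset χ (x t) ∧
    HasDerivAt x (∑ i, u t i • fl i t (x t)) t ∧
    ∑ i, u t i * ‖hl i t (x t)‖ = 0

/-- A bounded complete trajectory: the state stays in a compact subset of 𝒳. -/
def BoundedRange (𝒳 : Set (E n)) (x : ℝ → E n) : Prop :=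
  ∃ K : Set (E n), IsCompact K ∧ K ⊆ 𝒳 ∧ ∀ t : ℝ, x t ∈ K

end SwitchedSys

open SwitchedSys Filter Set MeasureTheory

open SwitchedSys Filter Set MeasureTheory Topology
section
namespace SwAux

/-- scalar weak-star sequential compactness, Hilbert version -/
lemma hilbert_weak_subseq {H : Type*} [NormedAddCommGroup H] [InnerProductSpace ℝ H]
    [CompleteSpace H] [TopologicalSpace.SeparableSpace H] (r : ℕ → H) (C : ℝ) (hr : ∀ k, ‖r k‖ ≤ C) :
    ∃ φ : ℕ → ℕ, StrictMono φ ∧ ∃ y : H, ∀ g : H,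
      Tendsto (fun k => inner ℝ (r (φ k)) g) atTop (𝓝 (inner ℝ y g)) := by
  have hs := WeakDual.isSeqCompact_closedBall ℝ H (0 : StrongDual ℝ H) C
  have hmem : ∀ k, StrongDual.toWeakDual (InnerProductSpace.toDual ℝ H (r k)) ∈
      (WeakDual.toStrongDual ⁻¹' Metric.closedBall (0 : StrongDual ℝ H) C) := by
    intro k
    simp only [mem_preimage, Metric.mem_closedBall, dist_zero_right]
    have : WeakDual.toStrongDual (StrongDual.toWeakDual (InnerProductSpace.toDual ℝ H (r k))) = 
      InnerProductSpace.toDual ℝ H (r k) := rfl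
    rw [this]
    simpa using hr k
  obtain ⟨a, ha, φ, hφ, hlim⟩ := hs hmem
  refine ⟨φ, hφ, (InnerProductSpace.toDual ℝ H).symm (WeakDual.toStrongDual a), fun g => ?_⟩
  have h1 := ((WeakBilin.eval_continuous (topDualPairing ℝ H) g).tendsto a).comp hlim
  have h2 : inner ℝ ((InnerProductSpace.toDual ℝ H).symm (WeakDual.toStrongDual a)) g = a g := by
    rw [InnerProductSpace.toDual_symm_apply]; rfl
  rw [h2]
  exact h1

def wt : ℝ → ℝ := fun x => Real.exp (-x^2)
lemma wt_pos (x : ℝ) : 0 < wt x := Real.exp_pos _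
lemma wt_cont : Continuous wt := by unfold wt; fun_prop
lemma wt_memLp : MemLp wt 2 volume := by
  rw [memLp_two_iff_integrable_sq wt_cont.aestronglyMeasurable]
  have := integrable_exp_neg_mul_sq (b := 2) (by norm_num)
  refine this.congr (Eventually.of_forall fun x => ?_)
  simp only [wt]
  rw [← Real.exp_nat_mul]; congr 1; push_cast; ring

lemma weak_scalar (v : ℕ → ℝ → ℝ) (hm : ∀ k, Measurable (v k)) (h0 : ∀ k t, 0 ≤ v k t)
    (h1 : ∀ k t, v k t ≤ 1) : ∃ φ : ℕ → ℕ, StrictMono φ ∧ ∃ u : ℝ → ℝ, Measurable u ∧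
      (∀ t, 0 ≤ u t) ∧ (∀ t, u t ≤ 1) ∧ ∀ g : ℝ → ℝ, Integrable g volume →
        Tendsto (fun k => ∫ t, g t * v (φ k) t) atTop (𝓝 (∫ t, g t * u t)) := by
  have hvw : ∀ k, MemLp (fun t => v k t * wt t) 2 volume := by
    intro k
    refine wt_memLp.of_le ((hm k).mul wt_cont.measurable).aestronglyMeasurable
      (Eventually.of_forall fun t => ?_)
    rw [norm_mul, Real.norm_of_nonneg (h0 k t)]
    exact mul_le_of_le_one_left (norm_nonneg _) (h1 k t)
  let r : ℕ → Lp ℝ 2 (volume : Measure ℝ) := fun k => (hvw k).toLp _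
  have : Fact ((2:ENNReal) ≠ ⊤) := ⟨by norm_num⟩
  obtain ⟨φ, hφ, y, hy⟩ := hilbert_weak_subseq r (‖wt_memLp.toLp wt‖) (by
    intro k
    refine Lp.norm_le_norm_of_ae_le ?_
    filter_upwards [(hvw k).coeFn_toLp, wt_memLp.coeFn_toLp] with t ht1 ht2
    rw [ht1, ht2, norm_mul, Real.norm_of_nonneg (h0 k t)]
    exact mul_le_of_le_one_left (norm_nonneg _) (h1 k t))
  -- convergence for test functions in L²
  have hL2 : ∀ g : ℝ → ℝ, MemLp g 2 volume →
      Tendsto (fun k => ∫ t, g t * (v (φ k) t * wt t)) atTop (𝓝 (∫ t, g t * y t)) := by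
    intro g hg
    have := hy (hg.toLp g)
    simp only [L2.inner_def] at this
    convert this using 1
    · funext k
      refine integral_congr_ae ?_
      filter_upwards [(hvw (φ k)).coeFn_toLp, hg.coeFn_toLp] with t ht1 ht2
      simp only [r]
      rw [ht1, ht2]; simp
    · congr 1
      refine integral_congr_ae ?_
      filter_upwards [hg.coeFn_toLp] with t ht2
      rw [ht2]; simp
  have hset : ∀ s : Set ℝ, MeasurableSet s → volume s < ⊤ → 
      Tendsto (fun k => ∫ t in s, v (φ k) t * wt t) atTop (𝓝 (∫ t in s, y t)) := by
    intro s hs hsf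
    have := hL2 (s.indicator fun _ => 1) (memLp_indicator_const 2 hs 1 (Or.inr hsf.ne))
    convert this using 1
    · funext k
      rw [← integral_indicator hs]; congr 1; funext t
      by_cases h : t ∈ s <;> simp [h]
    · congr 1; rw [← integral_indicator hs]; congr 1; funext t
      by_cases h : t ∈ s <;> simp [h]
  have hyint : ∀ s : Set ℝ, volume s < ⊤ → IntegrableOn y s volume := by
    intro s hsf
    have : IsFiniteMeasure (volume.restrict s) := ⟨by simpa using hsf⟩
    exact ((Lp.memLp y).restrict s).integrable (by norm_num)
  have hwint : ∀ s : Set ℝ, volume s < ⊤ → IntegrableOn wt s volume := by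
    intro s hsf
    have : IsFiniteMeasure (volume.restrict s) := ⟨by simpa using hsf⟩
    exact (wt_memLp.restrict s).integrable (by norm_num)
  have hvwint : ∀ k, ∀ s : Set ℝ, volume s < ⊤ → IntegrableOn (fun t => v k t * wt t) s volume := by
    intro k s hsf
    have : IsFiniteMeasure (volume.restrict s) := ⟨by simpa using hsf⟩
    exact ((hvw k).restrict s).integrable (by norm_num)
  have hy0 : 0 ≤ᵐ[volume] (y : ℝ → ℝ) := by
    refine ae_nonneg_of_forall_setIntegral_nonneg_of_sigmaFinite (fun s _ h => hyint s h) ?_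
    intro s hs hsf
    refine ge_of_tendsto' (hset s hs hsf) fun k => ?_
    exact integral_nonneg fun t => mul_nonneg (h0 _ t) (wt_pos t).le
  have hy1 : 0 ≤ᵐ[volume] fun t => wt t - y t := by
    refine ae_nonneg_of_forall_setIntegral_nonneg_of_sigmaFinite
      (fun s _ h => (hwint s h).sub (hyint s h)) ?_
    intro s hs hsf
    rw [integral_sub (hwint s hsf) (hyint s hsf), sub_nonneg]
    refine le_of_tendsto' (hset s hs hsf) fun k => ?_
    refine integral_mono (hvwint _ s hsf) (hwint s hsf) fun t => ?_
    exact mul_le_of_le_one_left (wt_pos t).le (h1 _ t)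
  have hym : Measurable (y : ℝ → ℝ) := (Lp.stronglyMeasurable y).measurable
  let u : ℝ → ℝ := fun t => max 0 (min 1 (y t / wt t))
  have hum : Measurable u := by
    exact measurable_const.max (measurable_const.min (hym.div wt_cont.measurable))
  have hu0 : ∀ t, 0 ≤ u t := fun t => le_max_left _ _
  have hu1 : ∀ t, u t ≤ 1 := fun t => max_le zero_le_one (min_le_left _ _)
  have huy : ∀ᵐ t, u t * wt t = y t := by
    filter_upwards [hy0, hy1] with t ht0 ht1
    simp only [Pi.zero_apply] at ht0 ht1
    have hw := wt_pos t
    have a1 : y t / wt t ≤ 1 := by rw [div_le_one hw]; linarith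
    have a0 : 0 ≤ y t / wt t := div_nonneg ht0 hw.le
    simp only [u]
    rw [min_eq_right a1, max_eq_right a0]; field_simp
  refine ⟨φ, hφ, u, hum, hu0, hu1, fun g hg => ?_⟩
  wlog hgm : Measurable g generalizing g with Hg
  · obtain ⟨g', hg', hgg⟩ := hg.aestronglyMeasurable
    have := Hg g' (hg.congr hgg) hg'.measurable
    convert this using 1
    · funext k; exact integral_congr_ae (hgg.mono fun t ht => by simp only [ht])
    · congr 1; exact integral_congr_ae (hgg.mono fun t ht => by simp only [ht])
  -- truncation
  let gm : ℕ → ℝ → ℝ := fun m => {t | |g t| ≤ m * wt t ^ 2}.indicator g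
  have hAm : ∀ m : ℕ, MeasurableSet {t | |g t| ≤ m * wt t ^ 2} := by
    intro m
    exact measurableSet_le (by fun_prop) (measurable_const.mul (wt_cont.measurable.pow_const 2))
  have hgmm : ∀ m, Measurable (gm m) := fun m => hgm.indicator (hAm m)
  have hgmle : ∀ m t, |gm m t| ≤ |g t| := by
    intro m t; simp only [gm, indicator]; split_ifs <;> simp
  have hgmle2 : ∀ m t, |gm m t| ≤ m * wt t ^ 2 := by
    intro m t; simp only [gm, indicator]; split_ifs with h
    · exact h
    · simp; have := wt_pos t; positivity
  have hgmint : ∀ m, Integrable (gm m) volume := fun m =>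
    hg.mono (hgmm m).aestronglyMeasurable (Eventually.of_forall fun t => by simpa using hgmle m t)
  have hgmtend : Tendsto (fun m => ∫ t, |g t - gm m t|) atTop (𝓝 0) := by
    have : (0:ℝ) = ∫ t : ℝ, (0:ℝ) := by simp
    rw [this]
    refine tendsto_integral_of_dominated_convergence (fun t => |g t|) ?_ hg.abs ?_ ?_
    · intro m; exact (by have := hgmm m; fun_prop : Measurable _).aestronglyMeasurable
    · intro m; refine Eventually.of_forall fun t => ?_
      simp only [gm, indicator]; split_ifs <;> simp
    · refine Eventually.of_forall fun t => ?_
      obtain ⟨M, hM⟩ := exists_nat_ge (|g t| / wt t ^ 2)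
      refine tendsto_const_nhds.congr' ?_
      filter_upwards [eventually_ge_atTop M] with m hm
      have hw := wt_pos t
      have : |g t| ≤ m * wt t ^ 2 := by
        rw [div_le_iff₀ (by positivity)] at hM
        refine hM.trans ?_
        gcongr
      simp [gm, this]
  have hconv : ∀ m, Tendsto (fun k => ∫ t, gm m t * v (φ k) t) atTop (𝓝 (∫ t, gm m t * u t)) := by
    intro m
    have hmem : MemLp (fun t => gm m t / wt t) 2 volume := by
      refine (wt_memLp.const_mul (m:ℝ)).of_le ((hgmm m).div wt_cont.measurable).aestronglyMeasurable
        (Eventually.of_forall fun t => ?_)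
      have hw := wt_pos t
      rw [norm_div, norm_mul, Real.norm_of_nonneg hw.le, Real.norm_of_nonneg (Nat.cast_nonneg m),
        div_le_iff₀ hw]
      have := hgmle2 m t
      rw [Real.norm_eq_abs]; nlinarith
    have := hL2 _ hmem
    convert this using 1
    · funext k; congr 1; funext t; have := (wt_pos t).ne'; field_simp
    · congr 1; refine integral_congr_ae (huy.mono fun t ht => ?_)
      simp only
      rw [← ht]; have := (wt_pos t).ne'; field_simp
  have hbd : ∀ (q : ℝ → ℝ), Measurable q → (∀ t, 0 ≤ q t) → (∀ t, q t ≤ 1) → ∀ m,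
      |(∫ t, g t * q t) - ∫ t, gm m t * q t| ≤ ∫ t, |g t - gm m t| := by
    intro q hq hq0 hq1 m
    have hi : ∀ p : ℝ → ℝ, Integrable p volume → Integrable (fun t => p t * q t) volume := by
      intro p hp
      refine hp.mono (hp.aestronglyMeasurable.mul hq.aestronglyMeasurable)
        (Eventually.of_forall fun t => ?_)
      rw [norm_mul, Real.norm_of_nonneg (hq0 t)]
      exact mul_le_of_le_one_right (norm_nonneg _) (hq1 t)
    rw [← integral_sub (hi _ hg) (hi _ (hgmint m))]
    refine (abs_integral_le_integral_abs).trans ?_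
    refine integral_mono ((hi _ hg).sub (hi _ (hgmint m))).abs (hg.sub (hgmint m)).abs fun t => ?_
    simp only
    rw [← sub_mul, abs_mul, abs_of_nonneg (hq0 t)]
    exact mul_le_of_le_one_right (abs_nonneg _) (hq1 t)
  rw [Metric.tendsto_atTop]
  intro ε hε
  obtain ⟨m, hm'⟩ := ((tendsto_order.1 hgmtend).2 (ε/3) (by positivity)).exists
  obtain ⟨k0, hk0⟩ := (Metric.tendsto_atTop.1 (hconv m)) (ε/3) (by positivity)
  refine ⟨k0, fun k hk => ?_⟩
  have e1 := hbd (v (φ k)) (hm _) (h0 _) (h1 _) m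
  have e2 := hbd u hum hu0 hu1 m
  have e3 := hk0 k hk
  rw [Real.dist_eq] at *
  rw [abs_le] at e1 e2
  rw [abs_lt] at *
  constructor <;> linarith [e1.1, e1.2, e2.1, e2.2, e3.1, e3.2]

end SwAux
end

open SwitchedSys Filter Set MeasureTheory Topology
section
namespace SwAux

lemma finite_subseq {ι : Type*} [Finite ι] (P : ι → (ℕ → ℕ) → Prop)
    (hmono : ∀ i (φ ψ : ℕ → ℕ), P i φ → StrictMono ψ → P i (φ ∘ ψ))
    (hex : ∀ i (φ : ℕ → ℕ), StrictMono φ → ∃ ψ : ℕ → ℕ, StrictMono ψ ∧ P i (φ ∘ ψ)) :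
    ∃ φ : ℕ → ℕ, StrictMono φ ∧ ∀ i, P i φ := by
  classical
  cases nonempty_fintype ι
  have : ∀ s : Finset ι, ∃ φ : ℕ → ℕ, StrictMono φ ∧ ∀ i ∈ s, P i φ := by
    intro s
    induction s using Finset.induction_on with
    | empty => exact ⟨id, strictMono_id, by simp⟩
    | insert i s hi ih =>
      obtain ⟨φ, hφ, h⟩ := ih
      obtain ⟨ψ, hψ, h'⟩ := hex i φ hφ
      refine ⟨φ ∘ ψ, hφ.comp hψ, fun j hj => ?_⟩
      rcases Finset.mem_insert.1 hj with rfl | hj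
      · exact h'
      · exact hmono _ _ _ (h j hj) hψ
  obtain ⟨φ, hφ, h⟩ := this Finset.univ
  exact ⟨φ, hφ, fun i => h i (Finset.mem_univ i)⟩

lemma mul_bdd_int {g q : ℝ → ℝ} (hg : Integrable g volume) (hq : Measurable q)
    (hq0 : ∀ t, 0 ≤ q t) (hq1 : ∀ t, q t ≤ 1) : Integrable (fun t => g t * q t) volume := by
  refine hg.mono (hg.aestronglyMeasurable.mul hq.aestronglyMeasurable)
    (Eventually.of_forall fun t => ?_)
  rw [norm_mul, Real.norm_of_nonneg (hq0 t)]
  exact mul_le_of_le_one_right (norm_nonneg _) (hq1 t)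

lemma simplex_le_one {N : ℕ} {μ : Fin N → ℝ} (h : μ ∈ simplexU N) (i : Fin N) : μ i ≤ 1 := by
  rw [← h.2]
  exact Finset.single_le_sum (fun j _ => h.1 j) (Finset.mem_univ i)

lemma weak_vec {N : ℕ} (v : ℕ → ℝ → Fin N → ℝ) (hm : ∀ k, Measurable (v k))
    (hs : ∀ k t, v k t ∈ simplexU N) :
    ∃ φ : ℕ → ℕ, StrictMono φ ∧ ∃ u, IsControl u ∧ WeakConv (fun k => v (φ k)) u := by
  obtain ⟨φ, hφ, hP⟩ := finite_subseq (ι := Fin N) (fun i φ => ∃ u : ℝ → ℝ, Measurable u ∧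
      (∀ t, 0 ≤ u t) ∧ (∀ t, u t ≤ 1) ∧ ∀ g : ℝ → ℝ, Integrable g volume →
        Tendsto (fun k => ∫ t, g t * v (φ k) t i) atTop (𝓝 (∫ t, g t * u t)))
    (by
      rintro i φ ψ ⟨u, h1, h2, h3, h4⟩ hψ
      exact ⟨u, h1, h2, h3, fun g hg => (h4 g hg).comp hψ.tendsto_atTop⟩)
    (by
      intro i φ hφ
      exact weak_scalar (fun k t => v (φ k) t i) (fun k => (measurable_pi_apply i).comp (hm _))
        (fun k t => (hs _ t).1 i) (fun k t => simplex_le_one (hs _ t) i))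
  choose w hwm hw0 hw1 hwc using hP
  have hvi : ∀ (g : ℝ → ℝ), Integrable g volume → ∀ k i,
      Integrable (fun t => g t * v k t i) volume := fun g hg k i =>
    mul_bdd_int (q := fun t => v k t i) hg ((measurable_pi_apply i).comp (hm k))
      (fun t => (hs _ t).1 i) (fun t => simplex_le_one (hs _ t) i)
  have hsum : ∀ᵐ t, ∑ i, w i t = 1 := by
    refine ae_eq_of_forall_setIntegral_eq_of_sigmaFinite (f := fun t => ∑ i, w i t) (g := fun _ => 1) ?_ ?_ ?_
    · intro s hs' hsf
      refine integrable_finsetSum _ fun i _ => ?_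
      have : IsFiniteMeasure (volume.restrict s) := ⟨by simpa using hsf⟩
      refine (integrable_const (1:ℝ)).mono (hwm i).aestronglyMeasurable (Eventually.of_forall fun t => ?_)
      rw [Real.norm_of_nonneg (hw0 i t)]; simpa using hw1 i t
    · intro s hs' hsf
      have : IsFiniteMeasure (volume.restrict s) := ⟨by simpa using hsf⟩
      exact integrable_const _
    · intro s hs' hsf
      have hg : Integrable (s.indicator fun _ => (1:ℝ)) volume :=
        (integrable_indicator_iff hs').2 (by
          have : IsFiniteMeasure (volume.restrict s) := ⟨by simpa using hsf⟩
          exact integrable_const _)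
      have t1 := tendsto_finsetSum (Finset.univ) (fun i _ => hwc i _ hg)
      have e1 : ∀ k, ∑ i, ∫ t, (s.indicator fun _ => (1:ℝ)) t * v (φ k) t i = ∫ t in s, (1:ℝ) := by
        intro k
        rw [← integral_finsetSum _ fun i _ => hvi _ hg (φ k) i]
        rw [← integral_indicator hs']
        congr 1; funext t
        rw [← Finset.mul_sum, (hs _ t).2, mul_one]
      have e2 : ∑ i, ∫ t, (s.indicator fun _ => (1:ℝ)) t * w i t = ∫ t in s, ∑ i, w i t := by
        rw [← integral_finsetSum _ fun i _ => mul_bdd_int hg (hwm i) (hw0 i) (hw1 i)]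
        rw [← integral_indicator hs']
        congr 1; funext t
        rw [← Finset.mul_sum]
        by_cases h : t ∈ s <;> simp [h]
      simp only [e1, e2] at t1
      exact tendsto_nhds_unique t1 tendsto_const_nhds
  classical
  let A : Set ℝ := {t | ∑ i, w i t = 1}
  have hA : MeasurableSet A := measurableSet_eq_fun (Finset.measurable_sum _ fun i _ => hwm i) measurable_const
  let u : ℝ → Fin N → ℝ := A.piecewise (fun t i => w i t) (fun _ => v 0 0)
  have hu : IsControl u := by
    constructor
    · exact Measurable.piecewise hA (measurable_pi_lambda _ hwm) measurable_const
    · intro t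
      by_cases h : t ∈ A
      · simp only [u, piecewise_eq_of_mem _ _ _ h]
        exact ⟨fun i => hw0 i t, h⟩
      · simp only [u, piecewise_eq_of_notMem _ _ _ h]
        exact hs 0 0
  refine ⟨φ, hφ, u, hu, fun g hg => ?_⟩
  have hgi : ∀ i, Integrable (fun t => g t i) volume := fun i => hg.eval i
  have t1 := tendsto_finsetSum (Finset.univ) (fun i _ => hwc i _ (hgi i))
  convert t1 using 1
  · funext k
    exact integral_finsetSum _ fun i _ => hvi _ (hgi i) (φ k) i
  · congr 1
    rw [← integral_finsetSum _ fun i _ => mul_bdd_int (hgi i) (hwm i) (hw0 i) (hw1 i)]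
    refine integral_congr_ae ?_
    filter_upwards [hsum] with t ht
    have : t ∈ A := ht
    simp [u, this]

/-! KL function construction -/
lemma exists_KL (S : Set (ℝ × ℝ × ℝ)) (hnn : ∀ p ∈ S, 0 ≤ p.1 ∧ 0 ≤ p.2.1 ∧ 0 ≤ p.2.2)
    (ha : ∀ ε > 0, ∃ δ > 0, ∀ p ∈ S, p.1 ≤ δ → p.2.2 ≤ ε)
    (hb : ∀ R : ℝ, ∃ M, ∀ p ∈ S, p.1 ≤ R → p.2.2 ≤ M)
    (hc : ∀ R : ℝ, ∀ ε > 0, ∃ L, ∀ p ∈ S, p.1 ≤ R → L ≤ p.2.1 → p.2.2 ≤ ε) :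
    ∃ β, ClassKL β ∧ ∀ p ∈ S, p.2.2 ≤ β p.1 p.2.1 := by
  let Y : ℝ → ℝ → Set ℝ := fun r t => {0} ∪ {y | ∃ p ∈ S, p.2.2 = y ∧ p.1 ≤ r ∧ t ≤ p.2.1}
  let B : ℝ → ℝ → ℝ := fun r t => sSup (Y r t)
  have hYne : ∀ r t, (Y r t).Nonempty := fun r t => ⟨0, Or.inl rfl⟩
  have hYb : ∀ r t, BddAbove (Y r t) := by
    intro r t
    obtain ⟨M, hM⟩ := hb r
    refine ⟨max M 0, ?_⟩
    rintro y (rfl | ⟨p, hp, rfl, hpr, _⟩)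
    · exact le_max_right _ _
    · exact (hM p hp hpr).trans (le_max_left _ _)
  have hB0 : ∀ r t, 0 ≤ B r t := fun r t => le_csSup (hYb r t) (Or.inl rfl)
  have hBle : ∀ r t c, 0 ≤ c → (∀ p ∈ S, p.1 ≤ r → t ≤ p.2.1 → p.2.2 ≤ c) → B r t ≤ c := by
    intro r t c hc0 h
    refine csSup_le (hYne r t) ?_
    rintro y (rfl | ⟨p, hp, rfl, hpr, hpt⟩)
    · exact hc0
    · exact h p hp hpr hpt
  have hBmono : ∀ t, Monotone fun r => B r t := by
    intro t r r' hr
    refine csSup_le_csSup (hYb r' t) (hYne r t) ?_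
    rintro y (rfl | ⟨p, hp, rfl, hpr, hpt⟩)
    · exact Or.inl rfl
    · exact Or.inr ⟨p, hp, rfl, hpr.trans hr, hpt⟩
  have hBanti : ∀ r, Antitone fun t => B r t := by
    intro r t t' ht
    refine csSup_le_csSup (hYb r t) (hYne r t') ?_
    rintro y (rfl | ⟨p, hp, rfl, hpr, hpt⟩)
    · exact Or.inl rfl
    · exact Or.inr ⟨p, hp, rfl, hpr, ht.trans hpt⟩
  have hBS : ∀ p ∈ S, p.2.2 ≤ B p.1 p.2.1 := by
    intro p hp
    exact le_csSup (hYb _ _) (Or.inr ⟨p, hp, rfl, le_rfl, le_rfl⟩)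
  have hBt : ∀ r, Tendsto (fun t => B r t) atTop (𝓝 0) := by
    intro r
    refine tendsto_order.2 ⟨fun a ha' => Eventually.of_forall fun t => ha'.trans_le (hB0 r t),
      fun a ha' => ?_⟩
    obtain ⟨L, hL⟩ := hc r (a/2) (by positivity)
    filter_upwards [eventually_ge_atTop L] with t ht
    refine (hBle r t (a/2) (by positivity) ?_).trans_lt (by linarith)
    exact fun p hp hpr hpt => hL p hp hpr (ht.trans hpt)
  have hBsm : ∀ ε > 0, ∃ δ > 0, ∀ r ≤ δ, ∀ t, B r t ≤ ε := by
    intro ε hε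
    obtain ⟨δ, hδ, h⟩ := ha ε hε
    exact ⟨δ, hδ, fun r hr t => hBle r t ε hε.le fun p hp hpr _ => h p hp (hpr.trans hr)⟩
  let A : ℝ → ℝ → ℝ := fun r t => ∫ v in (1:ℝ)..2, B (r * v) t
  have hintg : ∀ r, 0 ≤ r → ∀ t, IntervalIntegrable (fun v => B (r * v) t) volume 1 2 := by
    intro r hr t
    refine Monotone.intervalIntegrable fun v v' hv => hBmono t ?_
    exact mul_le_mul_of_nonneg_left hv hr
  have hconst : ∀ c : ℝ, ∫ _v in (1:ℝ)..2, c = c := by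
    intro c; simp; linarith
  have hAge : ∀ r, 0 ≤ r → ∀ t, B r t ≤ A r t := by
    intro r hr t
    rw [← hconst (B r t)]
    refine intervalIntegral.integral_mono_on (by norm_num) (by simp) (hintg r hr t) fun v hv => ?_
    exact hBmono t (le_mul_of_one_le_right hr hv.1)
  have hAle : ∀ r, 0 ≤ r → ∀ t, A r t ≤ B (r*2) t := by
    intro r hr t
    rw [← hconst (B (r*2) t)]
    refine intervalIntegral.integral_mono_on (by norm_num) (hintg r hr t) (by simp) fun v hv => ?_
    exact hBmono t (mul_le_mul_of_nonneg_left hv.2 hr)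
  have hA0 : ∀ r, 0 ≤ r → ∀ t, 0 ≤ A r t := fun r hr t => (hB0 r t).trans (hAge r hr t)
  have hAmono : ∀ t r r', 0 ≤ r → r ≤ r' → A r t ≤ A r' t := by
    intro t r r' hr hrr
    refine intervalIntegral.integral_mono_on (by norm_num) (hintg r hr t)
      (hintg r' (hr.trans hrr) t) fun v hv => ?_
    exact hBmono t (mul_le_mul_of_nonneg_right hrr (by linarith [hv.1]))
  have hAanti : ∀ r, 0 ≤ r → Antitone fun t => A r t := by
    intro r hr t t' ht
    exact intervalIntegral.integral_mono_on (by norm_num) (hintg r hr t')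
      (hintg r hr t) fun v hv => hBanti _ ht
  have hA00 : ∀ t, A 0 t = 0 := by
    intro t
    refine le_antisymm ?_ (hA0 0 le_rfl t)
    refine (hAle 0 le_rfl t).trans ?_
    refine le_of_forall_pos_le_add fun ε hε => ?_
    obtain ⟨δ, hδ, h⟩ := hBsm ε hε
    simpa using h 0 hδ.le t
  have hAcont : ∀ t, ContinuousOn (fun r => A r t) (Ici 0) := by
    intro t r hr
    rcases eq_or_lt_of_le (mem_Ici.1 hr) with h0 | hpos
    · subst h0
      have hlim : Tendsto (fun r => A r t) (𝓝[Ici 0] 0) (𝓝 0) := by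
        refine tendsto_order.2 ⟨fun a ha' => ?_, fun a ha' => ?_⟩
        · filter_upwards [self_mem_nhdsWithin] with r hr using ha'.trans_le (hA0 r hr t)
        · obtain ⟨δ, hδ, h⟩ := hBsm (a/2) (by positivity)
          filter_upwards [self_mem_nhdsWithin, mem_nhdsWithin_of_mem_nhds
            (Iio_mem_nhds (show (0:ℝ) < δ/2 by positivity))] with r hr hr2
          have h3 : r * 2 ≤ δ := by have : r < δ/2 := hr2; linarith
          linarith [hAle r hr t, h (r*2) h3 t]
      have h00 := hA00 t
      change Tendsto (fun r => A r t) (𝓝[Ici 0] 0) (𝓝 (A 0 t))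
      rw [h00]; exact hlim
    · have hc1 : Continuous fun x => ∫ v in (0:ℝ)..x, B v t :=
        intervalIntegral.continuous_primitive (fun a b => (hBmono t).intervalIntegrable) 0
      have heq : ∀ᶠ x in 𝓝 r, x⁻¹ * ((∫ v in (0:ℝ)..(x*2), B v t) - ∫ v in (0:ℝ)..x, B v t) = A x t := by
        filter_upwards [Ioi_mem_nhds hpos] with x hx
        have hx0 : x ≠ 0 := (ne_of_gt hx)
        simp only [A]
        rw [intervalIntegral.integral_comp_mul_left (fun v => B v t) hx0, mul_one, smul_eq_mul,
          intervalIntegral.integral_interval_sub_left] <;> exact (hBmono t).intervalIntegrable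
      refine ContinuousAt.continuousWithinAt (ContinuousAt.congr ?_ heq)
      refine (continuousAt_inv₀ hpos.ne').mul ?_
      exact ((hc1.comp (continuous_id.mul continuous_const)).sub hc1).continuousAt
  have hexp : ∀ t : ℝ, 0 < Real.exp (-t) := fun t => Real.exp_pos _
  refine ⟨fun r t => A r t + r * Real.exp (-t), ⟨?_, ?_⟩, ?_⟩
  · intro t _
    refine ⟨⟨?_, ?_, ?_⟩, ?_⟩
    · exact (hAcont t).add (by fun_prop)
    · intro r hr r' hr' hlt
      have := hAmono t r r' hr hlt.le
      have := mul_lt_mul_of_pos_right hlt (hexp t)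
      simp only; linarith
    · simp [hA00]
    · refine tendsto_atTop_mono' _ ?_ (tendsto_id.atTop_mul_const (hexp t))
      filter_upwards [eventually_ge_atTop 0] with r hr
      have := hA0 r hr t
      simp only [id]; linarith
  · intro r hr
    constructor
    · intro t _ t' _ htt
      have h1 := hAanti r hr htt
      have h2 : Real.exp (-t') ≤ Real.exp (-t) := Real.exp_le_exp.2 (by linarith)
      have := mul_le_mul_of_nonneg_left h2 hr
      simp only at *; linarith
    · have h1 : Tendsto (fun t => A r t) atTop (𝓝 0) :=
        squeeze_zero (fun t => hA0 r hr t) (fun t => hAle r hr t) (hBt _)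
      have h2 : Tendsto (fun t : ℝ => r * Real.exp (-t)) atTop (𝓝 (r * 0)) :=
        (Real.tendsto_exp_neg_atTop_nhds_zero).const_mul r
      simpa using h1.add h2
  · intro p hp
    obtain ⟨h1, h2, h3⟩ := hnn p hp
    have e1 := hBS p hp
    have e2 := hAge p.1 h1 p.2.1
    have := mul_nonneg h1 (hexp p.2.1).le
    simp only; linarith

end SwAux
end

open SwitchedSys Filter Set MeasureTheory Topology
section
namespace SwAux

/-- measurability of Caratheodory compositions -/
lemma cara_meas {X F : Type*} [TopologicalSpace X] [MeasurableSpace X] [TopologicalSpace F]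
    [TopologicalSpace.PseudoMetrizableSpace F] [MeasurableSpace F] [BorelSpace F]
    (g : ℝ → X → F) (K : Set X) (y : ℝ → X) (hy : Continuous y) (hyK : ∀ t, y t ∈ K)
    (hm : ∀ ξ ∈ K, Measurable fun t => g t ξ) (μ : Measure ℝ)
    (hc : ∀ᵐ t ∂μ, ContinuousOn (g t) K) : AEMeasurable (fun t => g t (y t)) μ := by
  let q : ℕ → ℝ → ℝ := fun m t => (⌊((m:ℝ)+1) * t⌋ : ℝ) / ((m:ℝ)+1)
  have hq : ∀ t, Tendsto (fun m => q m t) atTop (𝓝 t) := by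
    intro t
    have h1 : ∀ m : ℕ, |q m t - t| ≤ 1 / ((m:ℝ)+1) := by
      intro m
      have hp : (0:ℝ) < (m:ℝ)+1 := by positivity
      have e : q m t - t = ((⌊((m:ℝ)+1) * t⌋ : ℝ) - ((m:ℝ)+1) * t) / ((m:ℝ)+1) := by
        simp only [q]; field_simp
      rw [e, abs_div, abs_of_pos hp]
      gcongr
      have := Int.floor_le (((m:ℝ)+1) * t)
      have := Int.lt_floor_add_one (((m:ℝ)+1) * t)
      rw [abs_le]; constructor <;> linarith
    rw [tendsto_iff_norm_sub_tendsto_zero]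
    exact squeeze_zero (fun _ => norm_nonneg _) h1 tendsto_one_div_add_atTop_nhds_zero_nat
  refine aemeasurable_of_tendsto_metrizable_ae atTop (f := fun m t => g t (y (q m t))) ?_ ?_
  · intro m
    have h1 : Measurable (fun p : ℤ × ℝ => g p.2 (y ((p.1 : ℝ) / ((m:ℝ)+1)))) := by
      refine measurable_from_prod_countable_right fun z => ?_
      exact hm (y ((z : ℝ) / ((m:ℝ)+1))) (hyK _)
    have h2 : Measurable (fun t : ℝ => ((⌊((m:ℝ)+1) * t⌋ : ℤ), t)) := by
      refine Measurable.prodMk ?_ measurable_id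
      exact Int.measurable_floor.comp (measurable_const.mul measurable_id)
    exact (h1.comp h2).aemeasurable
  · filter_upwards [hc] with t ht
    have h1 : Tendsto (fun m => y (q m t)) atTop (𝓝[K] (y t)) :=
      tendsto_nhdsWithin_iff.2 ⟨(hy.tendsto t).comp (hq t), Eventually.of_forall fun m => hyK _⟩
    exact (ht (y t) (hyK t)).tendsto.comp h1

def clamp (a b t : ℝ) : ℝ := max a (min b t)
lemma clamp_cont (a b : ℝ) : Continuous (clamp a b) := by unfold clamp; fun_prop
lemma clamp_mem {a b : ℝ} (h : a ≤ b) (t : ℝ) : clamp a b t ∈ Icc a b :=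
  ⟨le_max_left _ _, max_le h (min_le_left _ _)⟩
lemma clamp_eq {a b t : ℝ} (h : t ∈ Icc a b) : clamp a b t = t := by
  unfold clamp; rw [min_eq_right h.2, max_eq_right h.1]
lemma clamp_lip (a b s t : ℝ) : |clamp a b s - clamp a b t| ≤ |s - t| := by
  unfold clamp
  have h1 := abs_max_sub_max_le_max a (min b s) a (min b t)
  have h2 := abs_min_sub_min_le_max b s b t
  simp only [sub_self, abs_zero] at h1 h2
  exact h1.trans (max_le (abs_nonneg _) (h2.trans (max_le (abs_nonneg _) le_rfl)))

lemma ae_of_full {J : Set ℝ} (hJ : volume (Ici (0:ℝ) \ J) = 0) : ∀ᵐ t : ℝ, 0 ≤ t → t ∈ J := by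
  rw [ae_iff]
  convert hJ using 2
  ext t; simp

lemma ubdd {X F ι : Type*} [Finite ι] [TopologicalSpace X] [NormedAddCommGroup F] {𝒳 : Set X}
    {g : ι → ℝ → X → F} (h : ∀ i, UnifBounded 𝒳 (g i)) {K : Set X} (hK : IsCompact K)
    (hKX : K ⊆ 𝒳) : ∃ C : ℝ, 0 ≤ C ∧ ∀ᵐ t : ℝ, 0 ≤ t → ∀ i, ∀ ξ ∈ K, ‖g i t ξ‖ ≤ C := by
  cases nonempty_fintype ι
  choose J hJ hJ0 hB using h
  choose C hC using fun i => hB i K hK hKX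
  refine ⟨∑ i, |C i|, by positivity, ?_⟩
  have : ∀ᵐ t : ℝ, ∀ i, 0 ≤ t → t ∈ J i := ae_all_iff.2 fun i => ae_of_full (hJ0 i)
  filter_upwards [this] with t ht h0 i ξ hξ
  refine (hC i t (ht i h0) ξ hξ).trans ((le_abs_self _).trans ?_)
  exact Finset.single_le_sum (f := fun i => |C i|) (fun j _ => abs_nonneg _) (Finset.mem_univ i)

lemma classK_tendsto {ω : ℝ → ℝ} (hω : ClassK ω) : Tendsto ω (𝓝[Ici 0] 0) (𝓝 0) := by
  have := hω.1 0 (by simp)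
  unfold ContinuousWithinAt at this
  rwa [hω.2.2] at this

/-- For a.e. t: uniform modulus. -/
lemma umod {X F ι : Type*} [Finite ι] [NormedAddCommGroup X] [NormedAddCommGroup F] {𝒳 : Set X}
    {g : ι → ℝ → X → F} (h : ∀ i, ContXiUnifT 𝒳 (g i)) {K : Set X} (hK : IsCompact K)
    (hKX : K ⊆ 𝒳) : ∃ ω : ι → ℝ → ℝ, (∀ i, ClassK (ω i)) ∧ ∀ᵐ t : ℝ, 0 ≤ t → ∀ i, ∀ ξ ∈ K, ∀ ζ ∈ K,
      ‖g i t ξ - g i t ζ‖ ≤ ω i ‖ξ - ζ‖ := by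
  choose J hJ hJ0 hB using h
  choose ω hω hC using fun i => hB i K hK hKX
  refine ⟨ω, hω, ?_⟩
  have : ∀ᵐ t : ℝ, ∀ i, 0 ≤ t → t ∈ J i := ae_all_iff.2 fun i => ae_of_full (hJ0 i)
  filter_upwards [this] with t ht h0 i ξ hξ ζ hζ
  exact hC i t (ht i h0) ξ hξ ζ hζ

lemma mod_cont {X F : Type*} [NormedAddCommGroup X] [NormedAddCommGroup F] {K : Set X}
    {g : X → F} {ω : ℝ → ℝ} (hω : ClassK ω) (h : ∀ ξ ∈ K, ∀ ζ ∈ K, ‖g ξ - g ζ‖ ≤ ω ‖ξ - ζ‖) :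
    ContinuousOn g K := by
  intro ξ hξ
  unfold ContinuousWithinAt
  rw [tendsto_iff_norm_sub_tendsto_zero]
  refine squeeze_zero' (Eventually.of_forall fun _ => norm_nonneg _)
    (eventually_mem_nhdsWithin.mono fun ζ hζ => h ζ hζ ξ hξ) ?_
  refine (classK_tendsto hω).comp (tendsto_nhdsWithin_iff.2 ⟨?_, Eventually.of_forall fun _ => norm_nonneg _⟩)
  have : Tendsto (fun ζ => ‖ζ - ξ‖) (𝓝 ξ) (𝓝 ‖ξ - ξ‖) := by
    exact ((continuous_id.sub continuous_const).norm).tendsto ξ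
  simp only [sub_self, norm_zero] at this
  exact this.mono_left nhdsWithin_le_nhds

variable {n N : ℕ} {𝒳 : Set (E n)} {f : ℝ → E n → Fin N → E n}

lemma lt_tf_of_le {T : Sol 𝒳 f} {a b : ℝ} (h : a ≤ b) (hb : (b : EReal) < T.tf) :
    (a : EReal) < T.tf := lt_of_le_of_lt (EReal.coe_le_coe_iff.2 h) hb

lemma sol_cont (T : Sol 𝒳 f) {a b : ℝ} (ha : T.t0 ≤ a) (hab : a ≤ b) (hb : (b : EReal) < T.tf) :
    ContinuousOn T.x (Icc a b) := by
  have h1 : ContinuousOn (fun t => T.x a + ∫ τ in a..t, f τ (T.x τ) (T.σ τ)) (Icc a b) := by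
    refine continuousOn_const.add ?_
    have := intervalIntegral.continuousOn_primitive_interval' (T.intg a b ha hab hb) (left_mem_uIcc)
    rwa [uIcc_of_le hab] at this
  refine h1.congr fun t ht => ?_
  exact T.sol a t ha ht.1 (lt_tf_of_le ht.2 hb)

lemma sol_lip (T : Sol 𝒳 f) {a b : ℝ} (ha : T.t0 ≤ a) (hb : (b : EReal) < T.tf)
    {K : Set (E n)} (hK : ∀ t ∈ Icc a b, T.x t ∈ K) {C : ℝ} 
    (hC : ∀ᵐ t : ℝ, 0 ≤ t → ∀ i, ∀ ξ ∈ K, ‖f t ξ i‖ ≤ C) :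
    ∀ s ∈ Icc a b, ∀ t ∈ Icc a b, ‖T.x t - T.x s‖ ≤ C * |t - s| := by
  have key : ∀ s ∈ Icc a b, ∀ t ∈ Icc a b, s ≤ t → ‖T.x t - T.x s‖ ≤ C * |t - s| := by
    intro s hs t ht hst
    rw [T.sol s t (ha.trans hs.1) hst (lt_tf_of_le ht.2 hb), add_sub_cancel_left]
    refine intervalIntegral.norm_integral_le_of_norm_le_const_ae ?_
    filter_upwards [hC] with τ hτ hm
    rw [uIoc_of_le hst] at hm
    have h0 := T.t0_nonneg
    exact hτ (by linarith [hm.1, hs.1]) _ _ (hK τ ⟨hs.1.trans hm.1.le, hm.2.trans ht.2⟩)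
  intro s hs t ht
  rcases le_total s t with h | h
  · exact key s hs t ht h
  · rw [norm_sub_rev, abs_sub_comm]; exact key t ht s hs h

/-- chain bound: uniform stability from multiple Lyapunov functions -/
lemma chain_bound (𝒯 : Set (Sol 𝒳 f)) (χ : Fin N → Set (E n)) (hinv : InvariantWrt 𝒯 χ)
    (V : ℝ → E n → Fin N → ℝ) (φ₁ φ₂ : ℝ → ℝ) (hφ₁ : ClassK φ₁) (hφ₂ : ClassK φ₂)
    (hsandwich : ∀ i : Fin N, ∀ t : ℝ, 0 ≤ t → ∀ ξ ∈ χ i ∩ 𝒳,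
      φ₁ ‖ξ‖ ≤ V t ξ i ∧ V t ξ i ≤ φ₂ ‖ξ‖)
    (hV_mono : ∀ T ∈ 𝒯, ∀ t s : ℝ, T.InDom t → t < s → (s : EReal) < T.tf →
      T.σ t = T.σ s → V s (T.x s) (T.σ t) ≤ V t (T.x t) (T.σ t))
    (r : ℕ → ℝ) (hr0 : ∀ j, 0 ≤ r j) (hrm : Monotone r) (hstep : ∀ j < N, φ₂ (r j) ≤ φ₁ (r (j+1)))
    (T : Sol 𝒳 f) (hT : T ∈ 𝒯) (s : ℝ) (hs : T.t0 ≤ s) (hs0 : ‖T.x s‖ ≤ r 0) (t : ℝ) (hst : s ≤ t)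
    (ht : (t : EReal) < T.tf) : ‖T.x t‖ ≤ r N := by
  classical
  rcases eq_or_lt_of_le hst with rfl | hlt
  · exact hs0.trans (hrm (Nat.zero_le N))
  obtain ⟨k, τ, hτ0, hτk, hτlt, hτσ⟩ := T.switching s t hlt
  have hτmono : ∀ j ≤ k, s ≤ τ j ∧ τ j ≤ t := by
    have up : ∀ j ≤ k, s ≤ τ j := by
      intro j; induction j with
      | zero => intro _; exact hτ0.ge
      | succ j ih => intro hj; exact (ih (by omega)).trans (hτlt j (by omega)).le
    have dn : ∀ d ≤ k, τ (k - d) ≤ t := by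
      intro d; induction d with
      | zero => intro _; exact hτk.le
      | succ d ih =>
        intro hd
        have := hτlt (k - (d+1)) (by omega)
        rw [show k - (d+1) + 1 = k - d by omega] at this
        exact this.le.trans (ih (by omega))
    intro j hj
    refine ⟨up j hj, ?_⟩
    have := dn (k - j) (by omega)
    rwa [show k - (k - j) = j by omega] at this
  have hcard : ∀ A : Finset (Fin N), A.card ≤ N := fun A => by
    simpa using Finset.card_le_univ A
  have inv : ∀ j ≤ k, ∃ A : Finset (Fin N), ‖T.x (τ j)‖ ≤ r A.card ∧
      ∀ i ∈ A, ∀ t', τ j ≤ t' → (t' : EReal) < T.tf → T.σ t' = i → ‖T.x t'‖ ≤ r A.card := by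
    intro j
    induction j with
    | zero => intro _; exact ⟨∅, by simpa [hτ0] using hs0, by simp⟩
    | succ j ih =>
      intro hj
      obtain ⟨A, hA1, hA2⟩ := ih (by omega)
      have hlt' := hτlt j (by omega)
      have hjt := hτmono j (by omega)
      have hjt1 := hτmono (j+1) hj
      -- a set A' that contains the current mode
      obtain ⟨A', hiA, hA'⟩ : ∃ A' : Finset (Fin N), T.σ (τ j) ∈ A' ∧ 
          ∀ i ∈ A', ∀ t', τ j ≤ t' → (t' : EReal) < T.tf → T.σ t' = i → ‖T.x t'‖ ≤ r A'.card := by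
        by_cases hmem : T.σ (τ j) ∈ A
        · exact ⟨A, hmem, hA2⟩
        · refine ⟨insert (T.σ (τ j)) A, Finset.mem_insert_self _ _, ?_⟩
          have hc := Finset.card_insert_of_notMem hmem
          intro i hi t' ht' htf hσ
          rw [hc]
          rcases Finset.mem_insert.1 hi with rfl | hi
          · have hdom : T.InDom (τ j) := ⟨hs.trans hjt.1, lt_tf_of_le hjt.2 ht⟩
            have h0 : 0 ≤ τ j := T.t0_nonneg.trans hdom.1
            have hN : A.card < N := by
              have := hcard (insert (T.σ (τ j)) A); omega
            have hVle : V t' (T.x t') (T.σ (τ j)) ≤ V (τ j) (T.x (τ j)) (T.σ (τ j)) := by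
              rcases eq_or_lt_of_le ht' with rfl | hl
              · exact le_rfl
              · exact hV_mono T hT (τ j) t' hdom hl htf hσ.symm
            have h1 := (hsandwich (T.σ (τ j)) (τ j) h0 (T.x (τ j)) ⟨hinv T hT _ hdom, T.mem _ hdom.1 hdom.2⟩).2
            have hdom' : T.InDom t' := ⟨hdom.1.trans ht', htf⟩
            have h2 := (hsandwich (T.σ t') t' (h0.trans ht') (T.x t') ⟨hinv T hT _ hdom', T.mem _ hdom'.1 hdom'.2⟩).1
            rw [hσ] at h2
            have h3 : φ₂ ‖T.x (τ j)‖ ≤ φ₂ (r A.card) :=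
              hφ₂.2.1.monotoneOn (norm_nonneg _) (hr0 _) hA1
            have h4 : φ₁ ‖T.x t'‖ ≤ φ₁ (r (A.card + 1)) := by
              linarith [hstep A.card hN]
            exact (hφ₁.2.1.le_iff_le (norm_nonneg _) (hr0 _)).1 h4
          · exact (hA2 i hi t' ht' htf hσ).trans (hrm (Nat.le_succ _))
      refine ⟨A', ?_, fun i hi t' ht' => hA' i hi t' (hlt'.le.trans ht')⟩
      have hcont := sol_cont T (hs.trans hjt.1) hlt'.le (lt_tf_of_le hjt1.2 ht)
      have hcl : τ (j+1) ∈ closure (Ico (τ j) (τ (j+1))) := by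
        rw [closure_Ico hlt'.ne]; exact right_mem_Icc.2 hlt'.le
      have hcw : ContinuousWithinAt (fun t => ‖T.x t‖) (Ico (τ j) (τ (j+1))) (τ (j+1)) :=
        ((hcont (τ (j+1)) (right_mem_Icc.2 hlt'.le)).norm).mono Ico_subset_Icc_self
      have : (𝓝[Ico (τ j) (τ (j+1))] (τ (j+1))).NeBot := mem_closure_iff_nhdsWithin_neBot.1 hcl
      refine le_of_tendsto hcw (eventually_mem_nhdsWithin.mono fun t' ht' => ?_)
      exact hA' _ hiA t' ht'.1 (lt_tf_of_le (ht'.2.le.trans hjt1.2) ht) (hτσ j (by omega) t' ht')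
  obtain ⟨A, hA, _⟩ := inv k le_rfl
  rw [hτk] at hA
  exact hA.trans (hrm (hcard A))

end SwAux
end

open SwitchedSys Filter Set MeasureTheory Topology
section
namespace SwAux
variable {n N : ℕ} {𝒳 : Set (E n)} {f : ℝ → E n → Fin N → E n}

lemma eta_intg (η : Fin N → ℝ → E n → ℝ) (hη_meas : ∀ i ξ, Measurable fun t => η i t ξ)
    (hη_cont : ∀ i, ∀ᵐ t ∂(volume.restrict (Ici (0:ℝ))), ContinuousOn (η i t) 𝒳)
    (hη_bdd : ∀ i, UnifBounded 𝒳 (η i)) (T : Sol 𝒳 f) {a b : ℝ} (ha : T.t0 ≤ a) (hab : a ≤ b)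
    (hb : (b : EReal) < T.tf) (i : Fin N) :
    IntervalIntegrable (fun τ => η i τ (T.x τ)) volume a b := by
  have hxc := sol_cont T ha hab hb
  have h0 : 0 ≤ a := T.t0_nonneg.trans ha
  let K := T.x '' Icc a b
  have hK : IsCompact K := isCompact_Icc.image_of_continuousOn hxc
  have hKX : K ⊆ 𝒳 := by
    rintro _ ⟨t, ht, rfl⟩
    exact T.mem t (ha.trans ht.1) (lt_tf_of_le ht.2 hb)
  obtain ⟨C, hC0, hC⟩ := ubdd hη_bdd hK hKX
  let y : ℝ → E n := fun t => T.x (clamp a b t)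
  have hy : Continuous y := by
    exact hxc.comp_continuous (clamp_cont a b) fun t => clamp_mem hab t
  have hm : AEMeasurable (fun τ => η i τ (y τ)) (volume.restrict (Icc a b)) := by
    refine cara_meas (η i) K y hy (fun t => ⟨_, clamp_mem hab t, rfl⟩) (fun ξ _ => hη_meas i ξ) _ ?_
    have := ae_restrict_of_ae_restrict_of_subset (s := Icc a b) (fun t ht => h0.trans ht.1) (hη_cont i)
    exact this.mono fun t ht => ht.mono hKX
  have hm' : AEMeasurable (fun τ => η i τ (T.x τ)) (volume.restrict (Icc a b)) := by
    refine hm.congr ?_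
    filter_upwards [ae_restrict_mem measurableSet_Icc] with t ht
    simp only [y, clamp_eq ht]
  rw [intervalIntegrable_iff_integrableOn_Icc_of_le hab]
  refine Integrable.mono' (g := fun _ => C) (integrable_const C) hm'.aestronglyMeasurable ?_
  filter_upwards [ae_restrict_mem measurableSet_Icc, ae_restrict_of_ae hC] with t ht htC
  exact htC (h0.trans ht.1) i _ ⟨t, ht, rfl⟩

lemma energy (hXopen : IsOpen 𝒳) (𝒯 : Set (Sol 𝒳 f)) (χ : Fin N → Set (E n)) (hinv : InvariantWrt 𝒯 χ)
    (V : ℝ → E n → Fin N → ℝ) 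
    (hV_smooth : ∀ i : Fin N,
      ContDiffOn ℝ 1 (fun q : ℝ × E n => V q.1 q.2 i) (Ici (0:ℝ) ×ˢ 𝒳))
    (η : Fin N → ℝ → E n → ℝ) (hη_meas : ∀ i ξ, Measurable fun t => η i t ξ)
    (hη_cont : ∀ i, ∀ᵐ t ∂(volume.restrict (Ici (0:ℝ))), ContinuousOn (η i t) 𝒳)
    (hV_decrease : ∀ i : Fin N, ∀ t : ℝ, 0 ≤ t → ∀ ξ ∈ χ i ∩ 𝒳,
      ∀ D : ℝ × E n →L[ℝ] ℝ,
        HasFDerivWithinAt (fun q : ℝ × E n => V q.1 q.2 i) D (Ici (0:ℝ) ×ˢ 𝒳) (t, ξ) →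
        D (1, f t ξ i) ≤ -(η i t ξ))
    (hf_bdd : ∀ i, UnifBounded 𝒳 fun t ξ => f t ξ i)
    (hη_bdd : ∀ i, UnifBounded 𝒳 (η i)) (T : Sol 𝒳 f) (hT : T ∈ 𝒯) {a b : ℝ} (ha : T.t0 ≤ a)
    (hab : a < b) (hb : (b : EReal) < T.tf) (i : Fin N) (hi : ∀ t ∈ Ico a b, T.σ t = i) :
    V b (T.x b) i + ∫ τ in a..b, η i τ (T.x τ) ≤ V a (T.x a) i := by
  have hxc := sol_cont T ha hab.le hb
  have h0 : 0 ≤ a := T.t0_nonneg.trans ha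
  let K := T.x '' Icc a b
  have hK : IsCompact K := isCompact_Icc.image_of_continuousOn hxc
  have hKX : K ⊆ 𝒳 := by
    rintro _ ⟨t, ht, rfl⟩
    exact T.mem t (ha.trans ht.1) (lt_tf_of_le ht.2 hb)
  obtain ⟨C, hC0, hC⟩ := ubdd hf_bdd hK hKX
  have hlip := sol_lip T ha hb (K := K) (fun t ht => ⟨t, ht, rfl⟩) hC
  let v : ℝ → ℝ := fun t => V t (T.x t) i
  -- v is Lipschitz
  have hpair : LipschitzOnWith (max 1 C.toNNReal) (fun t => (t, T.x t)) (Icc a b) := by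
    refine LipschitzOnWith.prodMk (LipschitzWith.id.lipschitzOnWith) ?_
    refine LipschitzOnWith.of_dist_le_mul fun s hs t ht => ?_
    rw [dist_eq_norm, Real.coe_toNNReal _ hC0, Real.dist_eq]
    exact hlip t ht s hs
  have hvl : LocallyLipschitzOn (Icc a b) v := by
    intro t ht
    have hxt : T.x t ∈ 𝒳 := hKX ⟨t, ht, rfl⟩
    obtain ⟨ρ, hρ, hball⟩ := Metric.isOpen_iff.1 hXopen _ hxt
    have hsub : Ici (0:ℝ) ×ˢ Metric.ball (T.x t) ρ ⊆ Ici (0:ℝ) ×ˢ 𝒳 := prod_mono_right hball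
    have hcd : ContDiffWithinAt ℝ 1 (fun q : ℝ × E n => V q.1 q.2 i)
        (Ici (0:ℝ) ×ˢ Metric.ball (T.x t) ρ) (t, T.x t) :=
      (hV_smooth i (t, T.x t) ⟨h0.trans ht.1, hxt⟩).mono hsub
    obtain ⟨M, s, hs, hsl⟩ := hcd.exists_lipschitzOnWith ((convex_Ici 0).prod (convex_ball _ _))
    have hev : ∀ᶠ t' in 𝓝[Icc a b] t, (t', T.x t') ∈ s := by
      have htend : Tendsto (fun t' => (t', T.x t')) (𝓝[Icc a b] t)
          (𝓝[Ici (0:ℝ) ×ˢ Metric.ball (T.x t) ρ] (t, T.x t)) := by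
        refine tendsto_nhdsWithin_iff.2 ⟨?_, ?_⟩
        · exact (hpair.continuousOn t ht).tendsto
        · have h1 : ∀ᶠ t' in 𝓝[Icc a b] t, T.x t' ∈ Metric.ball (T.x t) ρ :=
            (hxc t ht).tendsto.eventually (Metric.ball_mem_nhds _ hρ)
          filter_upwards [h1, eventually_mem_nhdsWithin] with t' h1 h2
          exact ⟨h0.trans h2.1, h1⟩
      exact htend.eventually hs
    refine ⟨M * max 1 C.toNNReal, {t' | (t', T.x t') ∈ s} ∩ Icc a b,
      inter_mem hev self_mem_nhdsWithin, ?_⟩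
    exact hsl.comp (hpair.mono inter_subset_right) fun t' ht' => ht'.1
  obtain ⟨M, hM⟩ := hvl.exists_lipschitzOnWith_of_compact isCompact_Icc
  have hac : AbsolutelyContinuousOnInterval v a b := by
    apply LipschitzOnWith.absolutelyContinuousOnInterval (K := M)
    rwa [uIcc_of_le hab.le]
  have hftc := hac.integral_deriv_eq_sub
  have hdi := hac.intervalIntegrable_deriv
  have hxd := (T.intg a b ha hab.le hb).ae_hasDerivAt_integral
  have hder : ∀ᵐ t : ℝ, t ∈ Ioo a b → deriv v t ≤ -(η i t (T.x t)) := by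
    filter_upwards [hxd] with t ht hti
    have hti' : t ∈ Icc a b := Ioo_subset_Icc_self hti
    have h1 := ht (by rwa [uIcc_of_le hab.le]) a left_mem_uIcc
    have hx : HasDerivAt T.x (f t (T.x t) (T.σ t)) t := by
      have h2 := h1.const_add (T.x a)
      refine h2.congr_of_eventuallyEq ?_
      filter_upwards [Ioo_mem_nhds hti.1 hti.2] with t' ht'
      exact T.sol a t' ha ht'.1.le (lt_tf_of_le ht'.2.le hb)
    have hσ : T.σ t = i := hi t (Ioo_subset_Ico_self hti)
    rw [hσ] at hx
    have hxt : T.x t ∈ 𝒳 := hKX ⟨t, hti', rfl⟩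
    have ht0 : 0 < t := h0.trans_lt hti.1
    have hnb : Ici (0:ℝ) ×ˢ 𝒳 ∈ 𝓝 (t, T.x t) :=
      prod_mem_nhds (Ici_mem_nhds ht0) (hXopen.mem_nhds hxt)
    have hda : DifferentiableAt ℝ (fun q : ℝ × E n => V q.1 q.2 i) (t, T.x t) :=
      ((hV_smooth i).contDiffAt hnb).differentiableAt (by norm_num)
    have hdec := hV_decrease i t ht0.le (T.x t)
      ⟨hσ ▸ hinv T hT t ⟨ha.trans hti'.1, lt_tf_of_le hti'.2 hb⟩, hxt⟩ _ hda.hasFDerivAt.hasFDerivWithinAt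
    have hcomp : HasDerivAt v ((fderiv ℝ (fun q : ℝ × E n => V q.1 q.2 i) (t, T.x t)) (1, f t (T.x t) i)) t :=
      HasFDerivAt.comp_hasDerivAt (l := fun q : ℝ × E n => V q.1 q.2 i) (f := fun s => (s, T.x s)) t
        hda.hasFDerivAt ((hasDerivAt_id' t).prodMk hx)
    rw [hcomp.deriv]
    exact hdec
  have hηi := eta_intg η hη_meas hη_cont hη_bdd T ha hab.le hb i
  have hle : ∫ t in a..b, deriv v t ≤ ∫ t in a..b, -(η i t (T.x t)) := by
    refine intervalIntegral.integral_mono_ae_restrict hab.le hdi hηi.neg ?_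
    rw [← restrict_Ioo_eq_restrict_Icc]
    filter_upwards [ae_restrict_of_ae hder, ae_restrict_mem measurableSet_Ioo] with t ht h using ht h
  rw [intervalIntegral.integral_neg, hftc] at hle
  simp only [v] at hle
  linarith

lemma int_bound (hXopen : IsOpen 𝒳) (𝒯 : Set (Sol 𝒳 f)) (χ : Fin N → Set (E n)) (hinv : InvariantWrt 𝒯 χ)
    (V : ℝ → E n → Fin N → ℝ) (hV_nonneg : ∀ t ξ i, 0 ≤ V t ξ i)
    (hV_smooth : ∀ i : Fin N,
      ContDiffOn ℝ 1 (fun q : ℝ × E n => V q.1 q.2 i) (Ici (0:ℝ) ×ˢ 𝒳))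
    (η : Fin N → ℝ → E n → ℝ) (hη_meas : ∀ i ξ, Measurable fun t => η i t ξ)
    (hη_cont : ∀ i, ∀ᵐ t ∂(volume.restrict (Ici (0:ℝ))), ContinuousOn (η i t) 𝒳)
    (hV_decrease : ∀ i : Fin N, ∀ t : ℝ, 0 ≤ t → ∀ ξ ∈ χ i ∩ 𝒳,
      ∀ D : ℝ × E n →L[ℝ] ℝ,
        HasFDerivWithinAt (fun q : ℝ × E n => V q.1 q.2 i) D (Ici (0:ℝ) ×ˢ 𝒳) (t, ξ) →
        D (1, f t ξ i) ≤ -(η i t ξ))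
    (hV_mono : ∀ T ∈ 𝒯, ∀ t s : ℝ, T.InDom t → t < s → (s : EReal) < T.tf →
      T.σ t = T.σ s → V s (T.x s) (T.σ t) ≤ V t (T.x t) (T.σ t))
    (hf_bdd : ∀ i, UnifBounded 𝒳 fun t ξ => f t ξ i)
    (hη_bdd : ∀ i, UnifBounded 𝒳 (η i)) (T : Sol 𝒳 f) (hT : T ∈ 𝒯) {a b : ℝ} (ha : T.t0 ≤ a)
    (hab : a < b) (hb : (b : EReal) < T.tf) (C : ℝ)
    (hC : ∀ t ∈ Icc a b, V t (T.x t) (T.σ t) ≤ C) :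
    IntervalIntegrable (fun τ => η (T.σ τ) τ (T.x τ)) volume a b ∧
    ∫ τ in a..b, η (T.σ τ) τ (T.x τ) ≤ N * C := by
  classical
  obtain ⟨k, τ, hτ0, hτk, hτlt, hτσ⟩ := T.switching a b hab
  have hτmono : ∀ j ≤ k, a ≤ τ j ∧ τ j ≤ b := by
    have up : ∀ j ≤ k, a ≤ τ j := by
      intro j; induction j with
      | zero => intro _; exact hτ0.ge
      | succ j ih => intro hj; exact (ih (by omega)).trans (hτlt j (by omega)).le
    have dn : ∀ d ≤ k, τ (k - d) ≤ b := by
      intro d; induction d with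
      | zero => intro _; exact hτk.le
      | succ d ih =>
        intro hd
        have := hτlt (k - (d+1)) (by omega)
        rw [show k - (d+1) + 1 = k - d by omega] at this
        exact this.le.trans (ih (by omega))
    intro j hj
    refine ⟨up j hj, ?_⟩
    have := dn (k - j) (by omega)
    rwa [show k - (k - j) = j by omega] at this
  have inv : ∀ j ≤ k, IntervalIntegrable (fun τ => η (T.σ τ) τ (T.x τ)) volume a (τ j) ∧
      ∃ m : Fin N → ℝ, (∀ i, 0 ≤ m i) ∧ 
      (∫ t in a..(τ j), η (T.σ t) t (T.x t)) + ∑ i, m i ≤ N * C ∧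
      ∀ t', τ j ≤ t' → t' ≤ b → V t' (T.x t') (T.σ t') ≤ m (T.σ t') := by
    intro j
    induction j with
    | zero =>
      intro _
      have hC0 : 0 ≤ C := (hV_nonneg _ _ _).trans (hC a (left_mem_Icc.2 hab.le))
      rw [hτ0]
      exact ⟨by simp, fun _ => C, fun _ => hC0, by simp, fun t' h1 h2 => hC t' ⟨h1, h2⟩⟩
    | succ j ih =>
      intro hj
      obtain ⟨hI, m, hm0, hms, hmV⟩ := ih (by omega)
      have hlt := hτlt j (by omega)
      have hj0 := hτmono j (by omega)
      have hj1 := hτmono (j+1) hj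
      have hta : T.t0 ≤ τ j := ha.trans hj0.1
      have htb : (τ (j+1) : EReal) < T.tf := lt_tf_of_le hj1.2 hb
      have hσ := hτσ j (by omega)
      have hen := energy hXopen 𝒯 χ hinv V hV_smooth η hη_meas hη_cont hV_decrease hf_bdd hη_bdd T hT
        hta hlt htb (T.σ (τ j)) hσ
      have hIi := eta_intg η hη_meas hη_cont hη_bdd T hta hlt.le htb (T.σ (τ j))
      have haeq : ∀ᵐ t : ℝ, t ∈ Ioc (τ j) (τ (j+1)) →
          η (T.σ (τ j)) t (T.x t) = η (T.σ t) t (T.x t) := by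
        have : ∀ᵐ t : ℝ, t ≠ τ (j+1) := by simp [ae_iff]
        filter_upwards [this] with t ht hti
        rw [hσ t ⟨hti.1.le, lt_of_le_of_ne hti.2 ht⟩]
      have hIσ : IntervalIntegrable (fun τ => η (T.σ τ) τ (T.x τ)) volume (τ j) (τ (j+1)) := by
        refine hIi.congr_ae ?_
        rw [uIoc_of_le hlt.le]
        exact (ae_restrict_iff' measurableSet_Ioc).2 haeq
      have hintg : ∫ t in (τ j)..(τ (j+1)), η (T.σ (τ j)) t (T.x t) =
          ∫ t in (τ j)..(τ (j+1)), η (T.σ t) t (T.x t) := by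
        refine intervalIntegral.integral_congr_ae ?_
        rwa [uIoc_of_le hlt.le]
      refine ⟨hI.trans hIσ, Function.update m (T.σ (τ j)) (V (τ (j+1)) (T.x (τ (j+1))) (T.σ (τ j))), ?_, ?_, ?_⟩
      · intro i
        by_cases h : i = T.σ (τ j)
        · subst h; simpa using hV_nonneg _ _ _
        · simpa [Function.update_of_ne h] using hm0 i
      · rw [← intervalIntegral.integral_add_adjacent_intervals hI hIσ, ← hintg]
        have h1 := Finset.sum_update_of_mem (Finset.mem_univ (T.σ (τ j))) m
          (V (τ (j+1)) (T.x (τ (j+1))) (T.σ (τ j)))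
        have h2 := Finset.add_sum_erase Finset.univ m (Finset.mem_univ (T.σ (τ j)))
        rw [Finset.sdiff_singleton_eq_erase] at h1
        have h3 := hmV (τ j) le_rfl hj0.2
        rw [h1]
        linarith
      · intro t' h1 h2
        by_cases h : T.σ t' = T.σ (τ j)
        · rw [h, Function.update_self]
          have hxc := sol_cont T hta hlt.le htb
          have hcl : τ (j+1) ∈ closure (Ico (τ j) (τ (j+1))) := by
            rw [closure_Ico hlt.ne]; exact right_mem_Icc.2 hlt.le
          have hne : (𝓝[Ico (τ j) (τ (j+1))] (τ (j+1))).NeBot := mem_closure_iff_nhdsWithin_neBot.1 hcl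
          have h00 : 0 ≤ τ j := T.t0_nonneg.trans hta
          have hcw : ContinuousWithinAt (fun t => V t (T.x t) (T.σ (τ j))) (Ico (τ j) (τ (j+1))) (τ (j+1)) := by
            have hc1 := (hV_smooth (T.σ (τ j))).continuousOn (τ (j+1), T.x (τ (j+1)))
              ⟨h00.trans hlt.le, T.mem _ (hta.trans hlt.le) htb⟩
            refine ContinuousWithinAt.comp (f := fun t => (t, T.x t)) (t := Ici (0:ℝ) ×ˢ 𝒳) hc1 ?_ ?_
            · exact continuousWithinAt_id.prodMk ((hxc _ (right_mem_Icc.2 hlt.le)).mono Ico_subset_Icc_self)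
            · intro t ht
              exact ⟨h00.trans ht.1, T.mem _ (hta.trans ht.1) (lt_tf_of_le ht.2.le htb)⟩
          refine ge_of_tendsto hcw (eventually_mem_nhdsWithin.mono fun s hs => ?_)
          have := hV_mono T hT s t' ⟨hta.trans hs.1, lt_tf_of_le hs.2.le htb⟩ (hs.2.trans_le h1)
            (lt_tf_of_le h2 hb) (by rw [hσ s hs, h])
          rwa [hσ s hs] at this
        · rw [Function.update_of_ne h]
          exact hmV t' (hlt.le.trans h1) h2
  obtain ⟨hI, m, hm0, hms, _⟩ := inv k le_rfl
  rw [hτk] at hI hms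
  refine ⟨hI, ?_⟩
  have := Finset.sum_nonneg (fun i (_ : i ∈ Finset.univ) => hm0 i)
  linarith

end SwAux
end

open SwitchedSys Filter Set MeasureTheory Topology
section
namespace SwAux
variable {n N : ℕ} {𝒳 : Set (E n)} {f : ℝ → E n → Fin N → E n}

lemma pigeon (F : ℝ → ℝ) (a l C : ℝ) (hl : 0 ≤ l) (m : ℕ) (hm : 0 < m)
    (hF : IntervalIntegrable F volume a (a + m * l)) (hC : ∫ t in a..(a + m * l), F t ≤ C) :
    ∃ j < m, ∫ t in (a + j * l)..(a + (j+1) * l), F t ≤ C / m := by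
  have hm' : (0:ℝ) < m := by exact_mod_cast hm
  have hsub : ∀ j < m, IntervalIntegrable F volume (a + (j:ℕ) * l) (a + ((j+1 : ℕ):ℝ) * l) := by
    intro j hj
    refine hF.mono_set ?_
    have hj' : ((j+1 : ℕ):ℝ) ≤ m := by exact_mod_cast hj
    have hj0 : (0:ℝ) ≤ j := by positivity
    have e1 : ((j+1 : ℕ):ℝ) * l ≤ m * l := by gcongr
    have e2 : (j:ℝ) * l ≤ ((j+1 : ℕ):ℝ) * l := by push_cast; nlinarith
    have e3 : 0 ≤ (j:ℝ) * l := by positivity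
    rw [uIcc_of_le (by linarith), uIcc_of_le (by linarith)]
    exact Icc_subset_Icc (by linarith) (by linarith)
  have hsum := intervalIntegral.sum_integral_adjacent_intervals (a := fun j : ℕ => a + (j:ℝ) * l)
    (n := m) hsub
  simp only [Nat.cast_zero, zero_mul, add_zero] at hsum
  have : ∑ j ∈ Finset.range m, ∫ t in (a + (j:ℕ) * l)..(a + ((j+1 : ℕ):ℝ) * l), F t
      ≤ ∑ j ∈ Finset.range m, C / m := by
    rw [hsum]; simp; rw [mul_div_cancel₀ _ hm'.ne']; exact hC
  obtain ⟨j, hj, h⟩ := Finset.exists_le_of_sum_le (Finset.nonempty_range_iff.2 hm.ne') this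
  refine ⟨j, Finset.mem_range.1 hj, ?_⟩
  push_cast at h
  exact h

lemma ae_zero (F : ℕ → ℝ → ℝ) (h0 : ∀ k s, 0 ≤ F k s) (C : ℝ)
    (hI : ∀ k : ℕ, IntervalIntegrable (F k) volume (-k) k)
    (hC : ∀ k : ℕ, ∫ s in (-(k:ℝ))..k, F k s ≤ C * (1/2)^k) :
    ∀ᵐ s : ℝ, Tendsto (fun k => F k s) atTop (𝓝 0) := by
  let G : ℕ → ℝ → ENNReal := fun k => (Ioc (-(k:ℝ)) k).indicator fun s => ENNReal.ofReal (F k s)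
  have hle : ∀ k : ℕ, (-(k:ℝ)) ≤ k := fun k => by
    have : (0:ℝ) ≤ k := by positivity
    linarith
  have hIk : ∀ k : ℕ, IntegrableOn (F k) (Ioc (-(k:ℝ)) k) := fun k =>
    (intervalIntegrable_iff_integrableOn_Ioc_of_le (hle k)).1 (hI k)
  have hGm : ∀ k, AEMeasurable (G k) := fun k =>
    (aemeasurable_indicator_iff measurableSet_Ioc).2 (hIk k).aemeasurable.ennreal_ofReal
  have hGi : ∀ k, ∫⁻ s, G k s ≤ ENNReal.ofReal (C * (1/2)^k) := by
    intro k
    rw [lintegral_indicator measurableSet_Ioc,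
      ← ofReal_integral_eq_lintegral_ofReal (hIk k) (Eventually.of_forall (h0 k)),
      ← intervalIntegral.integral_of_le (hle k)]
    exact ENNReal.ofReal_le_ofReal (hC k)
  have hC0 : 0 ≤ C := by
    have := hC 0
    simpa using this
  have hsum : ∑' k, ∫⁻ s, G k s ≠ ⊤ := by
    refine ne_top_of_le_ne_top ?_ (ENNReal.tsum_le_tsum hGi)
    rw [← ENNReal.ofReal_tsum_of_nonneg (fun k => by positivity)]
    · exact ENNReal.ofReal_ne_top
    · exact (summable_geometric_of_lt_one (by norm_num) (by norm_num)).mul_left C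
  rw [← lintegral_tsum hGm] at hsum
  have hfin := ae_lt_top' (AEMeasurable.tsum hGm) hsum
  filter_upwards [hfin] with s hs
  have h1 := ENNReal.tendsto_atTop_zero_of_tsum_ne_top hs.ne
  have h2 := (ENNReal.tendsto_toReal ENNReal.zero_ne_top).comp h1
  simp only [ENNReal.toReal_zero] at h2
  refine h2.congr' ?_
  filter_upwards [eventually_gt_atTop (⌈|s|⌉₊)] with k hk
  have hk' : |s| < k := (Nat.le_ceil _).trans_lt (by exact_mod_cast hk)
  have hm : s ∈ Ioc (-(k:ℝ)) k := ⟨(abs_lt.1 hk').1, (abs_lt.1 hk').2.le⟩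
  simp only [Function.comp, G, indicator_of_mem hm]
  exact ENNReal.toReal_ofReal (h0 k s)

lemma attr (hXopen : IsOpen 𝒳) (𝒯 : Set (Sol 𝒳 f)) (χ : Fin N → Set (E n)) (hinv : InvariantWrt 𝒯 χ)
    (V : ℝ → E n → Fin N → ℝ) (hV_nonneg : ∀ t ξ i, 0 ≤ V t ξ i)
    (φ₁ φ₂ : ℝ → ℝ) (hφ₂ : ClassK φ₂)
    (hsandwich : ∀ i : Fin N, ∀ t : ℝ, 0 ≤ t → ∀ ξ ∈ χ i ∩ 𝒳,
      φ₁ ‖ξ‖ ≤ V t ξ i ∧ V t ξ i ≤ φ₂ ‖ξ‖)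
    (hV_smooth : ∀ i : Fin N,
      ContDiffOn ℝ 1 (fun q : ℝ × E n => V q.1 q.2 i) (Ici (0:ℝ) ×ˢ 𝒳))
    (η : Fin N → ℝ → E n → ℝ) (hη_nonneg : ∀ i t ξ, 0 ≤ η i t ξ)
    (hη_meas : ∀ i ξ, Measurable fun t => η i t ξ)
    (hη_cont : ∀ i, ∀ᵐ t ∂(volume.restrict (Ici (0:ℝ))), ContinuousOn (η i t) 𝒳)
    (hV_decrease : ∀ i : Fin N, ∀ t : ℝ, 0 ≤ t → ∀ ξ ∈ χ i ∩ 𝒳,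
      ∀ D : ℝ × E n →L[ℝ] ℝ,
        HasFDerivWithinAt (fun q : ℝ × E n => V q.1 q.2 i) D (Ici (0:ℝ) ×ˢ 𝒳) (t, ξ) →
        D (1, f t ξ i) ≤ -(η i t ξ))
    (hV_mono : ∀ T ∈ 𝒯, ∀ t s : ℝ, T.InDom t → t < s → (s : EReal) < T.tf →
      T.σ t = T.σ s → V s (T.x s) (T.σ t) ≤ V t (T.x t) (T.σ t))
    (hf_bdd : ∀ i, UnifBounded 𝒳 fun t ξ => f t ξ i)
    (hη_bdd : ∀ i, UnifBounded 𝒳 (η i))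
    (hW : WZSD 𝒯 (fun t ξ i => η i t ξ)) (K : Set (E n)) (hK : IsCompact K) (hKX : K ⊆ 𝒳)
    (δ : ℝ) (hδ : 0 < δ) :
    ∃ L : ℝ, 0 < L ∧ ∀ T ∈ 𝒯, ∀ s, T.t0 ≤ s → ((s + L : ℝ) : EReal) < T.tf →
      ¬ ∀ τ ∈ Icc s (s + L), T.x τ ∈ K ∧ δ ≤ ‖T.x τ‖ := by
  by_contra hcon
  push Not at hcon
  obtain ⟨R, hR⟩ := hK.isBounded.exists_norm_le
  let C := (N:ℝ) * φ₂ R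
  have key : ∀ k : ℕ, ∃ t : ℝ, ∃ T ∈ 𝒯, T.t0 ≤ t - k ∧ ((t + k : ℝ) : EReal) < T.tf ∧
      (∀ s : ℝ, |s| ≤ k → T.x (t + s) ∈ K ∧ δ ≤ ‖T.x (t+s)‖) ∧
      IntervalIntegrable (fun τ => η (T.σ τ) τ (T.x τ)) volume (t - k) (t + k) ∧
      ∫ τ in (t - k)..(t + k), η (T.σ τ) τ (T.x τ) ≤ C * (1/2)^k := by
    intro k
    have hk0 : (0:ℝ) ≤ k := by positivity
    let m := 2^k
    let L : ℝ := m * (2 * k) + 1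
    have hL : 0 < L := by positivity
    obtain ⟨T, hT, s, hs, hsL, hx⟩ := hcon L hL
    have h00 : 0 ≤ s := T.t0_nonneg.trans hs
    have hVC : ∀ t ∈ Icc s (s+L), V t (T.x t) (T.σ t) ≤ φ₂ R := by
      intro t ht
      have hd : T.InDom t := ⟨hs.trans ht.1, lt_tf_of_le ht.2 hsL⟩
      have h1 := (hsandwich (T.σ t) t (h00.trans ht.1) (T.x t) ⟨hinv T hT t hd, T.mem _ hd.1 hd.2⟩).2
      have hn := hR _ (hx t ht).1
      exact h1.trans (hφ₂.2.1.monotoneOn (norm_nonneg _) ((norm_nonneg _).trans hn) hn)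
    obtain ⟨hI, hIC⟩ := int_bound hXopen 𝒯 χ hinv V hV_nonneg hV_smooth η hη_meas hη_cont hV_decrease
      hV_mono hf_bdd hη_bdd T hT hs (by linarith : s < s + L) hsL _ hVC
    have hml : 0 ≤ (m:ℝ) * (2 * k) := by positivity
    have hI' : IntervalIntegrable (fun τ => η (T.σ τ) τ (T.x τ)) volume s (s + m * (2*k)) := by
      refine hI.mono_set ?_
      rw [uIcc_of_le (by linarith), uIcc_of_le (by linarith)]
      exact Icc_subset_Icc le_rfl (by linarith)
    have hI'' : IntervalIntegrable (fun τ => η (T.σ τ) τ (T.x τ)) volume (s + m * (2*k)) (s+L) := by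
      refine hI.mono_set ?_
      rw [uIcc_of_le (by linarith), uIcc_of_le (by linarith)]
      exact Icc_subset_Icc (by linarith) le_rfl
    have hIC' : ∫ τ in s..(s + m * (2*k)), η (T.σ τ) τ (T.x τ) ≤ C := by
      have h1 := intervalIntegral.integral_add_adjacent_intervals hI' hI''
      have h2 : 0 ≤ ∫ τ in (s + m * (2*k))..(s+L), η (T.σ τ) τ (T.x τ) :=
        intervalIntegral.integral_nonneg (by linarith) fun _ _ => hη_nonneg _ _ _
      linarith
    obtain ⟨j, hj, hjC⟩ := pigeon _ s (2*k) C (by positivity) m (by positivity) hI' hIC'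
    have hj0 : (0:ℝ) ≤ j := by positivity
    have hj1 : (j:ℝ) + 1 ≤ m := by exact_mod_cast hj
    have e1 : ((j:ℝ)+1) * (2*k) ≤ m * (2*k) := by gcongr
    have e0 : 0 ≤ (j:ℝ) * (2*k) := by positivity
    refine ⟨s + j * (2*k) + k, T, hT, by linarith, lt_tf_of_le (by linarith) hsL, ?_, ?_, ?_⟩
    · intro r hr
      have := abs_le.1 hr
      refine hx _ ⟨by linarith, by linarith⟩
    · refine hI'.mono_set ?_
      rw [uIcc_of_le (by linarith), uIcc_of_le (by linarith)]
      exact Icc_subset_Icc (by linarith) (by linarith)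
    · rw [show s + j * (2*(k:ℝ)) + k - k = s + j * (2*k) by ring,
        show s + j * (2*(k:ℝ)) + k + k = s + (j + 1) * (2*k) by ring]
      refine hjC.trans (le_of_eq ?_)
      simp only [m]; push_cast
      rw [div_eq_mul_inv, one_div, inv_pow]
  choose t T hT h1 h2 h3 h4 h5 using key
  apply hW
  have htt : Tendsto t atTop atTop := by
    refine tendsto_atTop_mono (fun k => ?_) tendsto_natCast_atTop_atTop
    have := (T k).t0_nonneg
    linarith [h1 k]
  refine ⟨t, T, htt, hT, fun k => ⟨h1 k, h2 k⟩, ⟨K, hK, hKX, δ, hδ, h3⟩, ?_⟩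
  refine ae_zero (fun k s => η ((T k).σ (t k + s)) (t k + s) ((T k).x (t k + s)))
    (fun k s => hη_nonneg _ _ _) C ?_ ?_
  · intro k
    have := (h4 k).comp_add_left (t k)
    convert this using 1 <;> ring
  · intro k
    rw [intervalIntegral.integral_comp_add_left
      (fun τ => η ((T k).σ τ) τ ((T k).x τ)) (t k)]
    convert h5 k using 2
    ring
end SwAux
end

open SwitchedSys Filter Set MeasureTheory Topology
section
namespace SwAux
variable {n N : ℕ} {𝒳 : Set (E n)} {f : ℝ → E n → Fin N → E n}

lemma arzela (y : ℕ → ℝ → E n) (C : ℝ) (hC0 : 0 ≤ C) (hl : ∀ k s t, ‖y k s - y k t‖ ≤ C * |s - t|) (K : Set (E n))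
    (hK : IsCompact K) (hy : ∀ k s, y k s ∈ K) :
    ∃ φ : ℕ → ℕ, StrictMono φ ∧ ∃ x : ℝ → E n, ∀ s, Tendsto (fun k => y (φ k) s) atTop (𝓝 (x s)) := by
  have hcomp : IsCompact (Set.pi univ fun _ : ℚ => K) := isCompact_univ_pi fun _ => hK
  obtain ⟨z, -, φ, hφ, hz⟩ := hcomp.isSeqCompact (x := fun k (q : ℚ) => y k (q:ℝ))
    (fun k q _ => hy k _)
  rw [tendsto_pi_nhds] at hz
  refine ⟨φ, hφ, ?_⟩
  have : ∀ s, ∃ l, Tendsto (fun k => y (φ k) s) atTop (𝓝 l) := by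
    intro s
    apply cauchySeq_tendsto_of_complete
    rw [Metric.cauchySeq_iff]
    intro ε hε
    obtain ⟨q, hq1, hq2⟩ := exists_rat_btwn (show s < s + ε / (3 * (C+1)) by
      have : 0 < ε / (3 * (C+1)) := by positivity
      linarith)
    have hqs : C * |s - q| ≤ ε / 3 := by
      rw [abs_sub_comm, abs_of_pos (by linarith)]
      have : (q:ℝ) - s ≤ ε / (3 * (C+1)) := by linarith
      calc C * ((q:ℝ) - s) ≤ (C+1) * (ε / (3 * (C+1))) := by
            apply mul_le_mul (by linarith) this (by linarith) (by linarith)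
        _ = ε / 3 := by field_simp
    obtain ⟨M, hM⟩ := Metric.cauchySeq_iff.1 (hz q).cauchySeq (ε/3) (by positivity)
    refine ⟨M, fun a ha b hb => ?_⟩
    have h1 := hM a ha b hb
    simp only [Function.comp] at h1
    have h2 := hl (φ a) s q
    have h3 := hl (φ b) s q
    rw [← dist_eq_norm] at h2 h3
    have := dist_triangle4 (y (φ a) s) (y (φ a) q) (y (φ b) q) (y (φ b) s)
    rw [dist_comm (y (φ b) q)] at this
    linarith
  choose x hx using this
  exact ⟨x, hx⟩

lemma switch_meas {σ : ℝ → Fin N} (h : IsSwitchingSignal σ) : Measurable (ctrlOfSwitch σ) := by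
  let q : ℕ → ℝ → ℝ := fun m t => ((⌊((m:ℝ)+1) * t⌋ : ℝ) + 1) / ((m:ℝ)+1)
  have hq : ∀ t m, t < q m t ∧ q m t ≤ t + 1 / ((m:ℝ)+1) := by
    intro t m
    have hp : (0:ℝ) < (m:ℝ)+1 := by positivity
    have h1 := Int.floor_le (((m:ℝ)+1) * t)
    have h2 := Int.lt_floor_add_one (((m:ℝ)+1) * t)
    constructor
    · simp only [q]; rw [lt_div_iff₀ hp]; linarith
    · simp only [q]; rw [div_le_iff₀ hp]
      have h3 : (t + 1 / ((m:ℝ)+1)) * ((m:ℝ)+1) = ((m:ℝ)+1) * t + 1 := by field_simp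
      rw [h3]; linarith
  refine measurable_of_tendsto_metrizable (f := fun m t => ctrlOfSwitch σ (q m t)) ?_ ?_
  · intro m
    have h1 : Measurable (fun z : ℤ => ctrlOfSwitch σ (((z:ℝ) + 1) / ((m:ℝ)+1))) := measurable_from_top
    exact h1.comp (Int.measurable_floor.comp (measurable_const.mul measurable_id))
  · rw [tendsto_pi_nhds]
    intro t
    refine tendsto_const_nhds.congr' ?_
    obtain ⟨k, τ, h0, hk, hlt, hσ⟩ := h t (t+1) (by linarith)
    have hkpos : 0 < k := by
      rcases Nat.eq_zero_or_pos k with rfl | h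
      · rw [h0] at hk; linarith
      · exact h
    have h1 := hlt 0 hkpos
    rw [h0] at h1
    have h2 : ∀ᶠ m : ℕ in atTop, 1 / ((m:ℝ)+1) < τ (0+1) - t :=
      tendsto_one_div_add_atTop_nhds_zero_nat.eventually_lt_const (by linarith)
    filter_upwards [h2] with m hm
    have h3 := hσ 0 hkpos (q m t) (by rw [h0]; exact ⟨(hq t m).1.le, by linarith [(hq t m).2]⟩)
    rw [h0] at h3
    simp only [ctrlOfSwitch, h3]

lemma ctrl_simplex (σ : ℝ → Fin N) (t : ℝ) : ctrlOfSwitch σ t ∈ simplexU N := by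
  refine ⟨fun i => ?_, ?_⟩
  · simp only [ctrlOfSwitch, stdVec]; split_ifs <;> norm_num
  · simp [ctrlOfSwitch, stdVec]

lemma ctrl_sum {F : Type*} [AddCommGroup F] [Module ℝ F] (σ : ℝ → Fin N) (t : ℝ) (g : Fin N → F) :
    ∑ i, ctrlOfSwitch σ t i • g i = g (σ t) := by
  simp [ctrlOfSwitch, stdVec, ite_smul]

lemma shift_ae {P : ℝ → Prop} (h : ∀ᵐ τ : ℝ, P τ) (t : ℕ → ℝ) : ∀ᵐ s : ℝ, ∀ k, P (t k + s) := by
  rw [ae_all_iff]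
  intro k
  exact (measurePreserving_add_left volume (t k)).quasiMeasurePreserving.ae h

lemma ptlim {F : Type*} [NormedAddCommGroup F] (G : Fin N → ℝ → E n → F) 
    (hG : ∀ i, ContXiUnifT 𝒳 (G i)) (t : ℕ → ℝ) (ht : Tendsto t atTop atTop)
    (Gl : Fin N → ℝ → E n → F) (hGl : ∀ i, IsLimitAlong 𝒳 (G i) t (Gl i)) (K : Set (E n))
    (hK : IsCompact K) (hKX : K ⊆ 𝒳) (y : ℕ → ℝ → E n) (hy : ∀ k s, y k s ∈ K) (x : ℝ → E n)
    (hx : ∀ s, x s ∈ K) (hyx : ∀ s, Tendsto (fun k => y k s) atTop (𝓝 (x s))) :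
    ∀ᵐ s : ℝ, ∀ i, Tendsto (fun k => G i (t k + s) (y k s)) atTop (𝓝 (Gl i s (x s))) := by
  obtain ⟨ω, hω, hmod⟩ := umod hG hK hKX
  choose Ev hE0 hE using hGl
  have hE' : ∀ᵐ s : ℝ, ∀ i, s ∉ Ev i := ae_all_iff.2 fun i => by
    rw [ae_iff]; simpa using hE0 i
  filter_upwards [shift_ae hmod t, hE'] with s hs hsE i
  have h1 := hE i (x s) (hKX (hx s)) s (hsE i)
  have hdiff : Tendsto (fun k => G i (t k + s) (y k s) - G i (t k + s) (x s)) atTop (𝓝 0) := by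
    rw [tendsto_zero_iff_norm_tendsto_zero]
    have hn : Tendsto (fun k => ‖y k s - x s‖) atTop (𝓝 0) :=
      tendsto_iff_norm_sub_tendsto_zero.1 (hyx s)
    refine squeeze_zero' (Eventually.of_forall fun _ => norm_nonneg _) ?_
      ((classK_tendsto (hω i)).comp (tendsto_nhdsWithin_iff.2 ⟨hn, Eventually.of_forall fun _ => norm_nonneg _⟩))
    filter_upwards [ht.eventually_ge_atTop (-s)] with k hk
    exact hs k (by linarith) i _ (hy k s) _ (hx s)
  have := hdiff.add h1
  simpa using this

lemma meas_shift {F : Type*} [NormedAddCommGroup F] [MeasurableSpace F] [BorelSpace F]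
    (G : Fin N → ℝ → E n → F) (hGm : ∀ i, ∀ ξ ∈ 𝒳, Measurable fun t => G i t ξ)
    (hG : ∀ i, ContXiUnifT 𝒳 (G i)) (K : Set (E n))
    (hK : IsCompact K) (hKX : K ⊆ 𝒳) (y : ℝ → E n) (hyc : Continuous y) (hy : ∀ s, y s ∈ K) 
    (t a b : ℝ) (hta : 0 ≤ t + a) (i : Fin N) :
    AEMeasurable (fun s => G i (t + s) (y s)) (volume.restrict (Icc a b)) := by
  obtain ⟨ω, hω, hmod⟩ := umod hG hK hKX
  refine cara_meas (fun s ξ => G i (t + s) ξ) K y hyc hy 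
    (fun ξ hξ => (hGm i ξ (hKX hξ)).comp (measurable_const.add measurable_id)) _ ?_
  filter_upwards [ae_restrict_of_ae (shift_ae hmod fun _ => t), ae_restrict_mem measurableSet_Icc] with s hs hsm
  exact mod_cont (hω i) (hs 0 (by linarith [hsm.1]) i)

lemma wlim (v : ℕ → ℝ → Fin N → ℝ) (u : ℝ → Fin N → ℝ) (hvm : ∀ k, Measurable (v k))
    (hvs : ∀ k t, v k t ∈ simplexU N) (hu : IsControl u) (hv : WeakConv v u)
    (g : ℕ → ℝ → Fin N → ℝ) (gl : ℝ → Fin N → ℝ) (a b C : ℝ)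
    (hm : ∀ᶠ k in atTop, ∀ i, AEMeasurable (fun s => g k s i) (volume.restrict (Icc a b)))
    (hb : ∀ᶠ k in atTop, ∀ᵐ s ∂(volume.restrict (Icc a b)), ∀ i, |g k s i| ≤ C)
    (hl : ∀ᵐ s ∂(volume.restrict (Icc a b)), ∀ i, Tendsto (fun k => g k s i) atTop (𝓝 (gl s i))) :
    IntegrableOn (fun s => ∑ i, u s i * gl s i) (Icc a b) ∧
    Tendsto (fun k => ∫ s in Icc a b, ∑ i, v k s i * g k s i) atTop
      (𝓝 (∫ s in Icc a b, ∑ i, u s i * gl s i)) := by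
  obtain ⟨k0, hk0⟩ := eventually_atTop.1 (hm.and hb)
  have hglm : ∀ i, AEMeasurable (fun s => gl s i) (volume.restrict (Icc a b)) := fun i =>
    aemeasurable_of_tendsto_metrizable_ae atTop (f := fun k s => g (k + k0) s i)
      (fun k => (hk0 (k+k0) (by omega)).1 i)
      (hl.mono fun s hs => (hs i).comp (tendsto_add_atTop_nat k0))
  have hglb : ∀ᵐ s ∂(volume.restrict (Icc a b)), ∀ i, |gl s i| ≤ C := by
    have : ∀ᵐ s ∂(volume.restrict (Icc a b)), ∀ k ≥ k0, ∀ i, |g k s i| ≤ C := by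
      rw [ae_all_iff]; intro k
      by_cases hk : k0 ≤ k
      · exact (hk0 k hk).2.mono fun s hs _ => hs
      · exact Eventually.of_forall fun s h => absurd h hk
    filter_upwards [this, hl] with s hs hls i
    refine le_of_tendsto (hls i).abs ?_
    filter_upwards [eventually_ge_atTop k0] with k hk using hs k hk i
  have hgli : ∀ i, IntegrableOn (fun s => gl s i) (Icc a b) := fun i =>
    Integrable.mono' (g := fun _ => C) (integrable_const C) (hglm i).aestronglyMeasurable
      (hglb.mono fun s hs => hs i)
  have hmulI : ∀ w : ℝ → Fin N → ℝ, Measurable w → (∀ t, w t ∈ simplexU N) → 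
      IntegrableOn (fun s => ∑ i, w s i * gl s i) (Icc a b) := by
    intro w hw hws
    refine integrable_finsetSum _ fun i _ => ?_
    refine (hgli i).bdd_mul (c := 1) ?_ ?_
    · exact ((measurable_pi_apply i).comp hw).aestronglyMeasurable
    · refine Eventually.of_forall fun s => ?_
      rw [Real.norm_eq_abs, abs_of_nonneg ((hws s).1 i)]
      exact simplex_le_one (hws s) i
  refine ⟨hmulI u hu.1 hu.2, ?_⟩
  have hA : Tendsto (fun k => ∫ s in Icc a b, ∑ i, v k s i * gl s i) atTop
      (𝓝 (∫ s in Icc a b, ∑ i, u s i * gl s i)) := by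
    have := hv (fun s => (Icc a b).indicator (fun s => gl s) s) ?_
    · have e : ∀ w : ℝ → Fin N → ℝ, ∫ s, ∑ i, (Icc a b).indicator (fun s => gl s) s i * w s i =
          ∫ s in Icc a b, ∑ i, w s i * gl s i := by
        intro w
        rw [← integral_indicator measurableSet_Icc]
        congr 1; ext s
        by_cases hs : s ∈ Icc a b
        · simp only [indicator_of_mem hs, mul_comm]
        · simp [indicator_of_notMem hs]
      simp only [e] at this
      exact this
    · exact (integrable_indicator_iff measurableSet_Icc).2 (Integrable.of_eval hgli)
  have hB : Tendsto (fun k => ∫ s in Icc a b, ∑ i, v k s i * (g k s i - gl s i)) atTop (𝓝 0) := by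
    have : (0:ℝ) = ∫ s in Icc a b, (0:ℝ) := by simp
    rw [this]
    refine tendsto_integral_filter_of_dominated_convergence (fun _ => ∑ i : Fin N, 2 * C) ?_ ?_ ?_ ?_
    · filter_upwards [hm] with k hk
      refine AEMeasurable.aestronglyMeasurable (Finset.aemeasurable_fun_sum _ fun i _ => ?_)
      exact ((measurable_pi_apply i).comp (hvm k)).aemeasurable.mul ((hk i).sub (hglm i))
    · filter_upwards [hb] with k hk
      filter_upwards [hk, hglb] with s h1 h2
      refine (norm_sum_le _ _).trans (Finset.sum_le_sum fun i _ => ?_)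
      rw [norm_mul, Real.norm_eq_abs, Real.norm_eq_abs, abs_of_nonneg ((hvs k s).1 i)]
      have h3 := simplex_le_one (hvs k s) i
      have h4 := abs_sub (g k s i) (gl s i)
      have h5 := (hvs k s).1 i
      have := h1 i
      have := h2 i
      calc v k s i * |g k s i - gl s i| ≤ 1 * |g k s i - gl s i| := by gcongr
        _ ≤ 2 * C := by linarith
    · exact integrable_const _
    · filter_upwards [hl] with s hs
      have : (0:ℝ) = ∑ i : Fin N, (0:ℝ) := by simp
      rw [this]
      refine tendsto_finsetSum _ fun i _ => ?_
      have h0 : Tendsto (fun k => |g k s i - gl s i|) atTop (𝓝 0) := by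
        have := ((hs i).sub_const (gl s i)).abs
        simpa using this
      refine squeeze_zero_norm (fun k => ?_) h0
      rw [norm_mul, Real.norm_eq_abs, Real.norm_eq_abs, abs_of_nonneg ((hvs k s).1 i)]
      have h3 := simplex_le_one (hvs k s) i
      calc v k s i * |g k s i - gl s i| ≤ 1 * |g k s i - gl s i| := by gcongr
        _ = _ := one_mul _
  have := hA.add hB
  rw [add_zero] at this
  refine this.congr' ?_
  filter_upwards [hm, hb] with k hk hkb
  rw [← integral_add (hmulI (v k) (hvm k) (hvs k))]
  · congr 1; ext s
    rw [← Finset.sum_add_distrib]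
    exact Finset.sum_congr rfl fun i _ => by ring
  · refine integrable_finsetSum _ fun i _ => ?_
    refine Integrable.bdd_mul (c := 1) ?_ ?_ ?_
    · refine Integrable.sub ?_ (hgli i)
      exact Integrable.mono' (g := fun _ => C) (integrable_const C) (hk i).aestronglyMeasurable
        (hkb.mono fun s hs => hs i)
    · exact ((measurable_pi_apply i).comp (hvm k)).aestronglyMeasurable
    · refine Eventually.of_forall fun s => ?_
      rw [Real.norm_eq_abs, abs_of_nonneg ((hvs k s).1 i)]
      exact simplex_le_one (hvs k s) i

lemma wlim_vec (v : ℕ → ℝ → Fin N → ℝ) (u : ℝ → Fin N → ℝ) (hvm : ∀ k, Measurable (v k))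
    (hvs : ∀ k t, v k t ∈ simplexU N) (hu : IsControl u) (hv : WeakConv v u)
    (g : ℕ → ℝ → Fin N → E n) (gl : ℝ → Fin N → E n) (a b C : ℝ)
    (hm : ∀ᶠ k in atTop, ∀ i, AEMeasurable (fun s => g k s i) (volume.restrict (Icc a b)))
    (hb : ∀ᶠ k in atTop, ∀ᵐ s ∂(volume.restrict (Icc a b)), ∀ i, ‖g k s i‖ ≤ C)
    (hl : ∀ᵐ s ∂(volume.restrict (Icc a b)), ∀ i, Tendsto (fun k => g k s i) atTop (𝓝 (gl s i))) :
    IntegrableOn (fun s => ∑ i, u s i • gl s i) (Icc a b) ∧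
    Tendsto (fun k => ∫ s in Icc a b, ∑ i, v k s i • g k s i) atTop
      (𝓝 (∫ s in Icc a b, ∑ i, u s i • gl s i)) := by
  have key := fun r : Fin n => wlim v u hvm hvs hu hv (fun k s i => g k s i r) (fun s i => gl s i r) a b C
    (hm.mono fun k hk i => ((EuclideanSpace.proj r : E n →L[ℝ] ℝ).measurable.comp_aemeasurable (hk i)))
    (hb.mono fun k hk => hk.mono fun s hs i => (PiLp.norm_apply_le (g k s i) r).trans (hs i))
    (hl.mono fun s hs i => ((EuclideanSpace.proj r : E n →L[ℝ] ℝ).continuous.tendsto _).comp (hs i))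
  have hintg : IntegrableOn (fun s => ∑ i, u s i • gl s i) (Icc a b) := by
    rw [IntegrableOn, ← (EuclideanSpace.equiv (Fin n) ℝ).integrable_comp_iff]
    refine Integrable.of_eval fun r => ?_
    refine (key r).1.congr (Eventually.of_forall fun s => ?_)
    simp
  refine ⟨hintg, ?_⟩
  rw [(EuclideanSpace.equiv (Fin n) ℝ).toHomeomorph.isInducing.tendsto_nhds_iff, tendsto_pi_nhds]
  intro r
  have hgI : ∀ᶠ k in atTop, IntegrableOn (fun s => ∑ i, v k s i • g k s i) (Icc a b) := by
    filter_upwards [hm, hb] with k hk hkb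
    refine integrable_finsetSum _ fun i _ => ?_
    refine Integrable.bdd_smul (f := fun s => g k s i) (φ := fun s => v k s i) ?_ 1 ?_ ?_
    · exact Integrable.mono' (g := fun _ => C) (integrable_const C) (hk i).aestronglyMeasurable
        (hkb.mono fun s hs => hs i)
    · exact ((measurable_pi_apply i).comp (hvm k)).aestronglyMeasurable
    · refine Eventually.of_forall fun s => ?_
      rw [Real.norm_eq_abs, abs_of_nonneg ((hvs k s).1 i)]
      exact simplex_le_one (hvs k s) i
  have e : ∀ (w : ℝ → Fin N → ℝ) (h : ℝ → Fin N → E n), 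
      IntegrableOn (fun s => ∑ i, w s i • h s i) (Icc a b) →
      (∫ s in Icc a b, ∑ i, w s i • h s i) r = ∫ s in Icc a b, ∑ i, w s i * h s i r := by
    intro w h hi
    have := (EuclideanSpace.proj r : E n →L[ℝ] ℝ).integral_comp_comm hi
    rw [show (∫ s in Icc a b, ∑ i, w s i • h s i) r = 
      (EuclideanSpace.proj r : E n →L[ℝ] ℝ) (∫ s in Icc a b, ∑ i, w s i • h s i) from rfl, ← this]
    congr 1; ext s; simp
  have h2 := (key r).2
  rw [← e u gl hintg] at h2
  refine h2.congr' ?_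
  filter_upwards [hgI] with k hk
  rw [← e (v k) (g k) hk]
  rfl

end SwAux
end

open SwitchedSys Filter Set MeasureTheory Topology
section
namespace SwAux
variable {n N : ℕ} {𝒳 : Set (E n)} {f : ℝ → E n → Fin N → E n}

/-- Data of a sequence of trajectory windows converging pointwise. -/
structure Win (𝒯 : Set (Sol 𝒳 f)) (t : ℕ → ℝ) (T : ℕ → Sol 𝒳 f) (K : Set (E n)) (δ : ℝ)
    (xb : ℝ → E n) : Prop where
  htt : Tendsto t atTop atTop
  hT : ∀ k, T k ∈ 𝒯
  hw : ∀ k : ℕ, (T k).t0 ≤ t k - k ∧ ((t k + k : ℝ) : EReal) < (T k).tf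
  hK : IsCompact K
  hKX : K ⊆ 𝒳
  hδ : 0 < δ
  hxK : ∀ k : ℕ, ∀ s : ℝ, |s| ≤ (k : ℝ) → (T k).x (t k + s) ∈ K ∧ δ ≤ ‖(T k).x (t k + s)‖
  hxb : ∀ s, Tendsto (fun k => (T k).x (t k + s)) atTop (𝓝 (xb s))

/-- The windowed state, extended by clamping. -/
def yk (t : ℕ → ℝ) (T : ℕ → Sol 𝒳 f) (k : ℕ) (s : ℝ) : E n := (T k).x (t k + clamp (-k) k s)

lemma ev_abs (s : ℝ) : ∀ᶠ k : ℕ in atTop, |s| ≤ (k:ℝ) :=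
  tendsto_natCast_atTop_atTop.eventually_ge_atTop _

lemma neg_le_k (k : ℕ) : -(k:ℝ) ≤ k := by
  have : (0:ℝ) ≤ k := by positivity
  linarith

lemma ae_of_windows {P : ℝ → Prop} (h : ∀ m : ℕ, ∀ᵐ s ∂(volume.restrict (Icc (-(m:ℝ)) m)), P s) :
    ∀ᵐ s : ℝ, P s := by
  have : ∀ᵐ s : ℝ, ∀ m : ℕ, s ∈ Icc (-(m:ℝ)) m → P s :=
    ae_all_iff.2 fun m => (ae_restrict_iff' measurableSet_Icc).1 (h m)
  filter_upwards [this] with s hs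
  obtain ⟨m, hm⟩ := (ev_abs s).exists
  exact hs m (abs_le.1 hm)

section
variable {𝒯 : Set (Sol 𝒳 f)} {t : ℕ → ℝ} {T : ℕ → Sol 𝒳 f} {K : Set (E n)} {δ : ℝ} {xb : ℝ → E n}

lemma Win.yeq (k : ℕ) {s : ℝ} (hs : |s| ≤ (k:ℝ)) : yk t T k s = (T k).x (t k + s) := by
  rw [yk, clamp_eq (abs_le.1 hs)]

lemma Win.clamp_abs (k : ℕ) (s : ℝ) : |clamp (-k) k s| ≤ (k:ℝ) := abs_le.2 (clamp_mem (neg_le_k k) s)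

lemma Win.yK (W : Win 𝒯 t T K δ xb) (k : ℕ) (s : ℝ) : yk t T k s ∈ K := (W.hxK k _ (Win.clamp_abs k s)).1

lemma Win.yc (W : Win 𝒯 t T K δ xb) (k : ℕ) : Continuous (yk t T k) := by
  have hk := neg_le_k k
  have h := sol_cont (T k) (W.hw k).1 (by linarith) (W.hw k).2
  refine h.comp_continuous (f := fun s => t k + clamp (-k) k s) (continuous_const.add (clamp_cont _ _)) fun s => ?_
  have := clamp_mem hk s
  exact ⟨by linarith [this.1], by linarith [this.2]⟩

lemma Win.yx (W : Win 𝒯 t T K δ xb) (s : ℝ) : Tendsto (fun k => yk t T k s) atTop (𝓝 (xb s)) := by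
  refine (W.hxb s).congr' ?_
  filter_upwards [ev_abs s] with k hk
  exact (Win.yeq k hk).symm

lemma Win.xK (W : Win 𝒯 t T K δ xb) (s : ℝ) : xb s ∈ K :=
  W.hK.isClosed.mem_of_tendsto (W.yx s) (Eventually.of_forall fun k => W.yK k s)

lemma Win.xδ (W : Win 𝒯 t T K δ xb) (s : ℝ) : δ ≤ ‖xb s‖ :=
  ge_of_tendsto (W.yx s).norm (Eventually.of_forall fun k => (W.hxK k _ (Win.clamp_abs k s)).2)

lemma Win.xm (W : Win 𝒯 t T K δ xb) : Measurable xb :=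
  measurable_of_tendsto_metrizable (fun k => (W.yc k).measurable) (tendsto_pi_nhds.2 W.yx)

lemma Win.dom (W : Win 𝒯 t T K δ xb) {k : ℕ} {s : ℝ} (hs : |s| ≤ (k:ℝ)) : (T k).InDom (t k + s) := by
  have := abs_le.1 hs
  exact ⟨by linarith [(W.hw k).1], lt_tf_of_le (by linarith) (W.hw k).2⟩

lemma Win.pos (W : Win 𝒯 t T K δ xb) {k : ℕ} {s : ℝ} (hs : |s| ≤ (k:ℝ)) : 0 ≤ t k + s :=
  (T k).t0_nonneg.trans (W.dom hs).1

lemma Win.vm (t : ℕ → ℝ) (T : ℕ → Sol 𝒳 f) (k : ℕ) : 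
    Measurable (fun s => ctrlOfSwitch (T k).σ (t k + s)) :=
  (switch_meas (T k).switching).comp (measurable_const.add measurable_id)

lemma ev_win (a b : ℝ) : ∀ᶠ k : ℕ in atTop, ∀ s ∈ Icc a b, |s| ≤ (k:ℝ) := by
  filter_upwards [ev_abs a, ev_abs b] with k ha hb s hs
  have := abs_le.1 ha
  have := abs_le.1 hb
  exact abs_le.2 ⟨by linarith [hs.1], by linarith [hs.2]⟩

lemma Win.uset (W : Win 𝒯 t T K δ xb) (χ : Fin N → Set (E n)) (hχ_closed : ∀ i, IsClosed (χ i))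
    (hinv : InvariantWrt 𝒯 χ) (u : ℝ → Fin N → ℝ) (hu : IsControl u)
    (hv : WeakConv (fun k s => ctrlOfSwitch (T k).σ (t k + s)) u) :
    ∀ᵐ s : ℝ, u s ∈ Uset χ (xb s) := by
  classical
  have key : ∀ i, ∀ᵐ s : ℝ, xb s ∉ χ i → u s i = 0 := by
    intro i
    refine ae_of_windows fun m => ?_
    let g : ℝ → Fin N → ℝ := fun s j => if j = i then ({s | xb s ∉ χ i} : Set ℝ).indicator (fun _ => (1:ℝ)) s else 0
    have hset : MeasurableSet {s | xb s ∉ χ i} := (W.xm (hχ_closed i).measurableSet).compl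
    have hgb : ∀ s j, |g s j| ≤ 1 := by
      intro s j
      simp only [g, indicator]; split_ifs <;> simp
    have hw := wlim _ u (Win.vm t T) (fun k s => ctrl_simplex _ _) hu hv (fun _ => g) g (-(m:ℝ)) m 1
      (Eventually.of_forall fun k j => by
        simp only [g]
        split_ifs
        · exact (measurable_const.indicator hset).aemeasurable
        · exact aemeasurable_const)
      (Eventually.of_forall fun k => Eventually.of_forall fun s j => hgb s j)
      (Eventually.of_forall fun s j => tendsto_const_nhds)
    have h0 : Tendsto (fun k => ∫ s in Icc (-(m:ℝ)) m, ∑ j, ctrlOfSwitch (T k).σ (t k + s) j * g s j) atTop (𝓝 0) := by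
      have e : (0:ℝ) = ∫ s in Icc (-(m:ℝ)) m, (0:ℝ) := by simp
      rw [e]
      refine tendsto_integral_filter_of_dominated_convergence (fun _ => 1) ?_ ?_ ?_ ?_
      · refine Eventually.of_forall fun k => Measurable.aestronglyMeasurable ?_
        refine Finset.measurable_fun_sum _ fun j _ => ?_
        refine ((measurable_pi_apply j).comp (Win.vm t T k)).mul ?_
        simp only [g]
        split_ifs
        · exact (measurable_const.indicator hset)
        · exact measurable_const
      · refine Eventually.of_forall fun k => Eventually.of_forall fun s => ?_
        have := ctrl_sum (T k).σ (t k + s) (g s)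
        simp only [smul_eq_mul] at this
        rw [this]
        exact hgb _ _
      · exact integrable_const _
      · refine Eventually.of_forall fun s => ?_
        refine tendsto_const_nhds.congr' ?_
        by_cases hs : xb s ∉ χ i
        · filter_upwards [ev_abs s, (W.hxb s).eventually ((hχ_closed i).isOpen_compl.mem_nhds hs)] with k hk hk2
          have := ctrl_sum (T k).σ (t k + s) (g s)
          simp only [smul_eq_mul] at this
          rw [this]
          have h3 := hinv (T k) (W.hT k) _ (W.dom hk)
          have : (T k).σ (t k + s) ≠ i := by
            rintro h; rw [h] at h3; exact hk2 h3
          simp [g, this]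
        · refine Eventually.of_forall fun k => ?_
          simp [g, hs]
    have hz := tendsto_nhds_unique hw.2 h0
    have hnn : ∀ s, 0 ≤ ∑ j, u s j * g s j := fun s => Finset.sum_nonneg fun j _ => by
      refine mul_nonneg ((hu.2 s).1 j) ?_
      simp only [g, indicator]; split_ifs <;> simp
    rw [integral_eq_zero_iff_of_nonneg hnn hw.1] at hz
    filter_upwards [hz] with s hs hχ
    simpa [g, hχ] using hs
  filter_upwards [ae_all_iff.2 key] with s hs
  let A := Finset.univ.filter fun i => u s i ≠ 0
  have hA : ∑ i ∈ A, u s i = 1 := by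
    rw [Finset.sum_filter_ne_zero]; exact (hu.2 s).2
  have hmem : ∑ i ∈ A, u s i • stdVec N i ∈ Uset χ (xb s) := by
    refine (convex_convexHull ℝ _).sum_mem (fun i _ => (hu.2 s).1 i) hA fun i hi => ?_
    refine subset_convexHull ℝ _ ⟨i, ?_, rfl⟩
    by_contra h
    exact (Finset.mem_filter.1 hi).2 (hs i h)
  convert hmem using 1
  ext j
  simp only [Finset.sum_apply, Pi.smul_apply, stdVec, smul_eq_mul, mul_ite, mul_one, mul_zero,
    Finset.sum_ite_eq, A, Finset.mem_filter, Finset.mem_univ, true_and]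
  split_ifs with h
  · rfl
  · exact not_not.1 h

lemma Win.eta (W : Win 𝒯 t T K δ xb) (η : Fin N → ℝ → E n → ℝ) (hη_nonneg : ∀ i t ξ, 0 ≤ η i t ξ)
    (hη_meas : ∀ i ξ, Measurable fun t => η i t ξ) (hη_bdd : ∀ i, UnifBounded 𝒳 (η i))
    (hη_contu : ∀ i, ContXiUnifT 𝒳 (η i)) (hl : Fin N → ℝ → E n → ℝ)
    (hlim : ∀ i, IsLimitAlong 𝒳 (η i) t (hl i)) 
    (hz : ∀ᵐ s : ℝ, Tendsto (fun k => η ((T k).σ (t k + s)) (t k + s) ((T k).x (t k + s))) atTop (𝓝 0))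
    (u : ℝ → Fin N → ℝ) (hu : IsControl u)
    (hv : WeakConv (fun k s => ctrlOfSwitch (T k).σ (t k + s)) u) :
    ∀ᵐ s : ℝ, ∑ i, u s i * ‖hl i s (xb s)‖ = 0 := by
  obtain ⟨C, hC0, hC⟩ := ubdd hη_bdd W.hK W.hKX
  have hpt := ptlim η hη_contu t W.htt hl hlim K W.hK W.hKX (yk t T) W.yK xb W.xK W.yx
  have hnn : ∀ᵐ s : ℝ, ∀ i, 0 ≤ hl i s (xb s) := hpt.mono fun s hs i =>
    ge_of_tendsto (hs i) (Eventually.of_forall fun k => hη_nonneg _ _ _)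
  have hmeas : ∀ a b : ℝ, ∀ᶠ k : ℕ in atTop, ∀ i, 
      AEMeasurable (fun s => η i (t k + s) (yk t T k s)) (volume.restrict (Icc a b)) := by
    intro a b
    filter_upwards [ev_abs a] with k hk i
    exact meas_shift η (fun i ξ _ => hη_meas i ξ) hη_contu K W.hK W.hKX _ (W.yc k) (W.yK k) (t k) a b
      (W.pos hk) i
  have hbd : ∀ a b : ℝ, ∀ᶠ k : ℕ in atTop, ∀ᵐ s ∂(volume.restrict (Icc a b)), ∀ i, 
      |η i (t k + s) (yk t T k s)| ≤ C := by
    intro a b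
    filter_upwards [ev_win a b] with k hk
    filter_upwards [ae_restrict_of_ae (shift_ae hC t), ae_restrict_mem measurableSet_Icc] with s hs hm i
    exact hs k (W.pos (hk s hm)) i _ (W.yK k s)
  refine ae_of_windows fun m => ?_
  have hw := wlim _ u (Win.vm t T) (fun k s => ctrl_simplex _ _) hu hv 
    (fun k s i => η i (t k + s) (yk t T k s)) (fun s i => hl i s (xb s)) (-(m:ℝ)) m C
    (hmeas _ _) (hbd _ _) (ae_restrict_of_ae hpt)
  have h0 : Tendsto (fun k => ∫ s in Icc (-(m:ℝ)) m, ∑ j, ctrlOfSwitch (T k).σ (t k + s) j * 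
      η j (t k + s) (yk t T k s)) atTop (𝓝 0) := by
    have e : (0:ℝ) = ∫ s in Icc (-(m:ℝ)) m, (0:ℝ) := by simp
    rw [e]
    refine tendsto_integral_filter_of_dominated_convergence (fun _ => C) ?_ ?_ ?_ ?_
    · filter_upwards [hmeas (-(m:ℝ)) m] with k hk
      refine AEMeasurable.aestronglyMeasurable (Finset.aemeasurable_fun_sum _ fun j _ => ?_)
      exact ((measurable_pi_apply j).comp (Win.vm t T k)).aemeasurable.mul (hk j)
    · filter_upwards [hbd (-(m:ℝ)) m] with k hk
      filter_upwards [hk] with s hs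
      have := ctrl_sum (T k).σ (t k + s) (fun i => η i (t k + s) (yk t T k s))
      simp only [smul_eq_mul] at this
      rw [this]
      exact hs _
    · exact integrable_const _
    · filter_upwards [ae_restrict_of_ae hz] with s hs
      refine hs.congr' ?_
      filter_upwards [ev_abs s] with k hk
      have := ctrl_sum (T k).σ (t k + s) (fun i => η i (t k + s) (yk t T k s))
      simp only [smul_eq_mul] at this
      rw [this, Win.yeq k hk]
  have hz := tendsto_nhds_unique hw.2 h0
  rw [integral_eq_zero_iff_of_nonneg_ae ?_ hw.1] at hz
  · filter_upwards [hz, ae_restrict_of_ae hnn] with s hs hn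
    refine Eq.trans (Finset.sum_congr rfl fun i _ => ?_) hs
    rw [Real.norm_eq_abs, abs_of_nonneg (hn i)]
  · filter_upwards [ae_restrict_of_ae hnn] with s hn
    exact Finset.sum_nonneg fun i _ => mul_nonneg ((hu.2 s).1 i) (hn i)

lemma Win.delta (W : Win 𝒯 t T K δ xb) (η : Fin N → ℝ → E n → ℝ) (Δf : ℝ → E n → Fin N → E n)
    (hzp : ∀ i, ZeroingPair 𝒳 (η i) fun t ξ => Δf t ξ i) (s : ℝ)
    (hz : Tendsto (fun k => η ((T k).σ (t k + s)) (t k + s) ((T k).x (t k + s))) atTop (𝓝 0)) :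
    Tendsto (fun k => Δf (t k + s) ((T k).x (t k + s)) ((T k).σ (t k + s))) atTop (𝓝 0) := by
  rw [Metric.tendsto_nhds]
  intro ε hε
  have key : ∀ i, ∀ᶠ k in atTop, (T k).σ (t k + s) = i → 
      dist (Δf (t k + s) ((T k).x (t k + s)) i) 0 < ε := by
    intro i
    by_contra hcon
    have hf : ∃ᶠ k in atTop, ¬ ((T k).σ (t k + s) = i → dist (Δf (t k + s) ((T k).x (t k + s)) i) 0 < ε) :=
      not_eventually.1 hcon
    obtain ⟨ψ, hψ, hP⟩ := extraction_of_frequently_atTop (hf.and_eventually (ev_abs s))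
    have h1 : ∀ k, (T (ψ k)).σ (t (ψ k) + s) = i := fun k => by
      by_contra h; exact (hP k).1 fun h' => absurd h' h
    have h2 : ∀ k, ε ≤ dist (Δf (t (ψ k) + s) ((T (ψ k)).x (t (ψ k) + s)) i) 0 := fun k => by
      by_contra h; exact (hP k).1 fun _ => not_le.1 h
    have h3 := hzp i (fun k => t (ψ k) + s)
      (tendsto_atTop_add_const_right _ _ (W.htt.comp hψ.tendsto_atTop)) K W.hK W.hKX δ W.hδ
      (fun k => (T (ψ k)).x (t (ψ k) + s)) (fun k => (W.hxK _ _ (hP k).2).1)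
      (fun k => (W.hxK _ _ (hP k).2).2) (by
        have := hz.comp hψ.tendsto_atTop
        refine this.congr fun k => ?_
        simp only [Function.comp, h1 k])
    obtain ⟨k, hk⟩ := ((Metric.tendsto_nhds.1 h3) ε hε).exists
    exact absurd hk (not_lt.2 (h2 k))
  filter_upwards [eventually_all.2 key] with k hk
  exact hk _ rfl

lemma Win.ode (W : Win 𝒯 t T K δ xb) (η : Fin N → ℝ → E n → ℝ) (fhat Δf : ℝ → E n → Fin N → E n)
    (hdecomp : ∀ t ξ i, f t ξ i = fhat t ξ i + Δf t ξ i)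
    (hzp : ∀ i, ZeroingPair 𝒳 (η i) fun t ξ => Δf t ξ i)
    (hf_bdd : ∀ i, UnifBounded 𝒳 fun t ξ => f t ξ i)
    (hfhat_bdd : ∀ i, UnifBounded 𝒳 fun t ξ => fhat t ξ i)
    (hfhat_meas : ∀ i, ∀ ξ ∈ 𝒳, Measurable fun t => fhat t ξ i)
    (hfhat_cont : ∀ i, ContXiUnifT 𝒳 fun t ξ => fhat t ξ i)
    (fl : Fin N → ℝ → E n → E n)
    (hlim : ∀ i, IsLimitAlong 𝒳 (fun t ξ => fhat t ξ i) t (fl i)) 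
    (hz : ∀ᵐ s : ℝ, Tendsto (fun k => η ((T k).σ (t k + s)) (t k + s) ((T k).x (t k + s))) atTop (𝓝 0))
    (u : ℝ → Fin N → ℝ) (hu : IsControl u)
    (hv : WeakConv (fun k s => ctrlOfSwitch (T k).σ (t k + s)) u) (a b : ℝ) (hab : a ≤ b) :
    IntegrableOn (fun s => ∑ i, u s i • fl i s (xb s)) (Icc a b) ∧ 
    xb b = xb a + ∫ s in Icc a b, ∑ i, u s i • fl i s (xb s) := by
  obtain ⟨C, hC0, hC⟩ := ubdd hfhat_bdd W.hK W.hKX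
  obtain ⟨C', hC0', hC'⟩ := ubdd hf_bdd W.hK W.hKX
  have hpt := ptlim (fun i t ξ => fhat t ξ i) hfhat_cont t W.htt fl hlim K W.hK W.hKX (yk t T) W.yK xb W.xK W.yx
  have hmeas : ∀ᶠ k : ℕ in atTop, ∀ i, 
      AEMeasurable (fun s => fhat (t k + s) (yk t T k s) i) (volume.restrict (Icc a b)) := by
    filter_upwards [ev_abs a] with k hk i
    exact meas_shift (fun i t ξ => fhat t ξ i) hfhat_meas hfhat_cont K W.hK W.hKX _ (W.yc k) (W.yK k) (t k) a b
      (W.pos hk) i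
  have hbd : ∀ᶠ k : ℕ in atTop, ∀ᵐ s ∂(volume.restrict (Icc a b)), ∀ i, 
      ‖fhat (t k + s) (yk t T k s) i‖ ≤ C := by
    filter_upwards [ev_win a b] with k hk
    filter_upwards [ae_restrict_of_ae (shift_ae hC t), ae_restrict_mem measurableSet_Icc] with s hs hm i
    exact hs k (W.pos (hk s hm)) i _ (W.yK k s)
  have hw := wlim_vec _ u (Win.vm t T) (fun k s => ctrl_simplex _ _) hu hv 
    (fun k s i => fhat (t k + s) (yk t T k s) i) (fun s i => fl i s (xb s)) a b C
    hmeas hbd (ae_restrict_of_ae hpt)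
  refine ⟨hw.1, ?_⟩
  simp only [ctrl_sum] at hw
  -- integrability of f along the windows
  have hfI : ∀ᶠ k : ℕ in atTop, IntegrableOn 
      (fun s => f (t k + s) ((T k).x (t k + s)) ((T k).σ (t k + s))) (Icc a b) ∧
      (T k).x (t k + b) = (T k).x (t k + a) + 
        ∫ s in Icc a b, f (t k + s) ((T k).x (t k + s)) ((T k).σ (t k + s)) := by
    filter_upwards [ev_abs a, ev_abs b] with k ha hb
    have hi := (T k).intg (t k + a) (t k + b) (W.dom ha).1 (by linarith) (W.dom hb).2
    have hs := (T k).sol (t k + a) (t k + b) (W.dom ha).1 (by linarith) (W.dom hb).2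
    have hi' := hi.comp_add_left (t k)
    simp only [add_sub_cancel_left] at hi'
    refine ⟨(intervalIntegrable_iff_integrableOn_Icc_of_le hab).1 hi', ?_⟩
    rw [hs, integral_Icc_eq_integral_Ioc, ← intervalIntegral.integral_of_le hab,
      intervalIntegral.integral_comp_add_left
        (fun τ => f τ ((T k).x τ) ((T k).σ τ)) (t k)]
  have hgI : ∀ᶠ k : ℕ in atTop, IntegrableOn 
      (fun s => fhat (t k + s) (yk t T k s) ((T k).σ (t k + s))) (Icc a b) := by
    filter_upwards [hmeas, hbd] with k hm hb
    refine Integrable.mono' (g := fun _ => C) (integrable_const C) ?_ (hb.mono fun s hs => hs _)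
    have : (fun s => fhat (t k + s) (yk t T k s) ((T k).σ (t k + s))) = fun s => 
        ∑ i, ctrlOfSwitch (T k).σ (t k + s) i • fhat (t k + s) (yk t T k s) i := by
      ext1 s; rw [ctrl_sum]
    rw [this]
    refine AEMeasurable.aestronglyMeasurable (Finset.aemeasurable_fun_sum _ fun j _ => ?_)
    exact ((measurable_pi_apply j).comp (Win.vm t T k)).aemeasurable.smul (hm j)
  have hD : Tendsto (fun k => ∫ s in Icc a b, (f (t k + s) ((T k).x (t k + s)) ((T k).σ (t k + s)) -
      fhat (t k + s) (yk t T k s) ((T k).σ (t k + s)))) atTop (𝓝 0) := by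
    have e : (0 : E n) = ∫ s in Icc a b, (0 : E n) := by simp
    rw [e]
    refine tendsto_integral_filter_of_dominated_convergence (fun _ => C' + C) ?_ ?_ ?_ ?_
    · filter_upwards [hfI, hgI] with k h1 h2
      exact (h1.1.sub h2).aestronglyMeasurable
    · filter_upwards [hbd, ev_win a b] with k hk hk2
      filter_upwards [hk, ae_restrict_of_ae (shift_ae hC' t), ae_restrict_mem measurableSet_Icc] with s hs hs' hm
      refine (norm_sub_le _ _).trans (add_le_add ?_ (hs _))
      exact hs' k (W.pos (hk2 s hm)) _ _ (W.hxK k s (hk2 s hm)).1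
    · exact integrable_const _
    · filter_upwards [ae_restrict_of_ae hz] with s hs
      refine (W.delta η Δf hzp s hs).congr' ?_
      filter_upwards [ev_abs s] with k hk
      rw [Win.yeq k hk, hdecomp, add_sub_cancel_left]
  have hlim1 : Tendsto (fun k => (T k).x (t k + b) - (T k).x (t k + a)) atTop (𝓝 (xb b - xb a)) :=
    (W.hxb b).sub (W.hxb a)
  have hlim2 := hw.2.add hD
  rw [add_zero] at hlim2
  have := tendsto_nhds_unique hlim1 (hlim2.congr' ?_)
  · rw [← this]; abel
  · filter_upwards [hfI, hgI] with k h1 h2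
    rw [integral_sub h1.1 h2, h1.2]
    abel

end
end SwAux
end

open SwitchedSys Filter Set MeasureTheory Topology
section
namespace SwAux
variable {n N : ℕ} {𝒳 : Set (E n)} {f : ℝ → E n → Fin N → E n}

lemma limAlong_comp {X F : Type*} [TopologicalSpace F] {𝒳 : Set X} {g : ℝ → X → F} {γ : ℕ → ℝ}
    {gl : ℝ → X → F} (h : IsLimitAlong 𝒳 g γ gl) {ψ : ℕ → ℕ} (hψ : StrictMono ψ) :
    IsLimitAlong 𝒳 g (γ ∘ ψ) gl := by
  obtain ⟨A, hA, h⟩ := h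
  exact ⟨A, hA, fun ξ hξ s hs => (h ξ hξ s hs).comp hψ.tendsto_atTop⟩

lemma adm_comp {X F : Type*} [TopologicalSpace F] {𝒳 : Set X} {g : ℝ → X → F} {γ : ℕ → ℝ}
    (h : Admissible 𝒳 g γ) {ψ : ℕ → ℕ} (hψ : StrictMono ψ) : Admissible 𝒳 g (γ ∘ ψ) := by
  obtain ⟨h1, gl, h2⟩ := h
  exact ⟨h1.comp hψ.tendsto_atTop, gl, limAlong_comp h2 hψ⟩

lemma wzsd (fhat Δf : ℝ → E n → Fin N → E n)
    (hdecomp : ∀ t ξ i, f t ξ i = fhat t ξ i + Δf t ξ i)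
    (𝒯 : Set (Sol 𝒳 f)) (χ : Fin N → Set (E n)) (hχ_closed : ∀ i, IsClosed (χ i))
    (hinv : InvariantWrt 𝒯 χ)
    (η : Fin N → ℝ → E n → ℝ) (hη_nonneg : ∀ i t ξ, 0 ≤ η i t ξ)
    (hη_meas : ∀ i ξ, Measurable fun t => η i t ξ)
    (hf_bdd : ∀ i, UnifBounded 𝒳 fun t ξ => f t ξ i)
    (hη_bdd : ∀ i, UnifBounded 𝒳 (η i))
    (hη_contu : ∀ i, ContXiUnifT 𝒳 (η i))
    (hη_pre : ∀ i, Precompact 𝒳 (η i))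
    (hfhat_bdd : ∀ i, UnifBounded 𝒳 fun t ξ => fhat t ξ i)
    (hfhat_meas : ∀ i, ∀ ξ ∈ 𝒳, Measurable fun t => fhat t ξ i)
    (hfhat_cont : ∀ i, ContXiUnifT 𝒳 fun t ξ => fhat t ξ i)
    (hfhat_pre : ∀ i, Precompact 𝒳 fun t ξ => fhat t ξ i)
    (hzp : ∀ i, ZeroingPair 𝒳 (η i) fun t ξ => Δf t ξ i)
    (hred : ∀ γ : ℕ → ℝ, Tendsto γ atTop atTop →
      ∀ (fl : Fin N → ℝ → E n → E n) (hlm : Fin N → ℝ → E n → ℝ),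
        (∀ i, IsLimitAlong 𝒳 (fun t ξ => fhat t ξ i) γ (fl i)) →
        (∀ i, IsLimitAlong 𝒳 (η i) γ (hlm i)) →
        ∀ (x : ℝ → E n) (u : ℝ → Fin N → ℝ),
          BoundedRange 𝒳 x →
          CompleteTrajOf 𝒯 χ fl hlm x u →
          (⨅ t : ℝ, ‖x t‖) = 0) : WZSD 𝒯 (fun t ξ i => η i t ξ) := by
  rintro ⟨t, T, htt, hT, hw, ⟨K, hK, hKX, δ, hδ, hxK⟩, hz⟩
  obtain ⟨C, hC0, hC⟩ := ubdd hf_bdd hK hKX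
  have hlip : ∀ k s s', ‖yk t T k s - yk t T k s'‖ ≤ C * |s - s'| := by
    intro k s s'
    have hk := neg_le_k k
    have h1 := sol_lip (T k) (hw k).1 (hw k).2 (K := K) (fun τ hτ => by
      have := (hxK k (τ - t k) (abs_le.2 ⟨by linarith [hτ.1], by linarith [hτ.2]⟩)).1
      simpa using this) hC (t k + clamp (-k) k s') ⟨by linarith [(clamp_mem hk s').1], by linarith [(clamp_mem hk s').2]⟩
      (t k + clamp (-k) k s) ⟨by linarith [(clamp_mem hk s).1], by linarith [(clamp_mem hk s).2]⟩
    refine h1.trans ?_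
    rw [add_sub_add_left_eq_sub]
    exact mul_le_mul_of_nonneg_left (clamp_lip _ _ _ _) hC0
  obtain ⟨φ0, hφ0, xb, hxb⟩ := arzela (yk t T) C hC0 hlip K hK
    (fun k s => (hxK k _ (Win.clamp_abs k s)).1)
  obtain ⟨φ1, hφ1, hadm⟩ := finite_subseq (ι := Fin N) 
    (fun i φ => Admissible 𝒳 (fun t ξ => fhat t ξ i) ((t ∘ φ0) ∘ φ) ∧ Admissible 𝒳 (η i) ((t ∘ φ0) ∘ φ))
    (fun i φ ψ h hψ => ⟨adm_comp h.1 hψ, adm_comp h.2 hψ⟩)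
    (fun i φ hφ => by
      obtain ⟨ψ1, h1, h2⟩ := hfhat_pre i ((t ∘ φ0) ∘ φ) ((htt.comp hφ0.tendsto_atTop).comp hφ.tendsto_atTop)
      obtain ⟨ψ2, h3, h4⟩ := hη_pre i (((t ∘ φ0) ∘ φ) ∘ ψ1) h2.1
      exact ⟨ψ1 ∘ ψ2, h1.comp h3, adm_comp h2 h3, h4⟩)
  choose h1 fl hfl using fun i => (hadm i).1
  choose h2 hl hhl using fun i => (hadm i).2
  obtain ⟨φ2, hφ2, u, hu, hweak⟩ := weak_vec (fun k s => ctrlOfSwitch (T (φ0 (φ1 k))).σ (t (φ0 (φ1 k)) + s))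
    (fun k => Win.vm t T _) (fun k s => ctrl_simplex _ _)
  let Φ := φ0 ∘ (φ1 ∘ φ2)
  have hΦ : StrictMono Φ := hφ0.comp (hφ1.comp hφ2)
  have hcast : ∀ k : ℕ, (k:ℝ) ≤ Φ k := fun k => by exact_mod_cast hΦ.id_le k
  have W : Win 𝒯 (fun k => t (Φ k)) (fun k => T (Φ k)) K δ xb := by
    refine ⟨htt.comp hΦ.tendsto_atTop, fun k => hT _, fun k => ⟨?_, ?_⟩, hK, hKX, hδ, ?_, ?_⟩
    · have := (hw (Φ k)).1
      linarith [hcast k]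
    · exact lt_tf_of_le (by linarith [hcast k]) (hw (Φ k)).2
    · intro k s hs
      exact hxK _ _ (hs.trans (hcast k))
    · intro s
      have := (hxb s).comp (hφ1.comp hφ2).tendsto_atTop
      refine this.congr' ?_
      filter_upwards [ev_abs s] with k hk
      exact Win.yeq (Φ k) (hk.trans (hcast k))
  have hzW : ∀ᵐ s : ℝ, Tendsto (fun k => η ((T (Φ k)).σ (t (Φ k) + s)) (t (Φ k) + s) ((T (Φ k)).x (t (Φ k) + s)))
      atTop (𝓝 0) := hz.mono fun s hs => hs.comp hΦ.tendsto_atTop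
  have hflW : ∀ i, IsLimitAlong 𝒳 (fun t ξ => fhat t ξ i) (fun k => t (Φ k)) (fl i) :=
    fun i => limAlong_comp (hfl i) hφ2
  have hhlW : ∀ i, IsLimitAlong 𝒳 (η i) (fun k => t (Φ k)) (hl i) :=
    fun i => limAlong_comp (hhl i) hφ2
  have hv : WeakConv (fun k s => ctrlOfSwitch (T (Φ k)).σ (t (Φ k) + s)) u := hweak
  have hode := W.ode η fhat Δf hdecomp hzp hf_bdd hfhat_bdd hfhat_meas hfhat_cont fl hflW hzW u hu hv
  have hii : ∀ a b : ℝ, IntervalIntegrable (fun s => ∑ i, u s i • fl i s (xb s)) volume a b := by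
    intro a b
    rcases le_total a b with h | h
    · exact (intervalIntegrable_iff_integrableOn_Icc_of_le h).2 (hode a b h).1
    · exact ((intervalIntegrable_iff_integrableOn_Icc_of_le h).2 (hode b a h).1).symm
  have hxint : ∀ s : ℝ, xb s = xb 0 + ∫ r in (0:ℝ)..s, ∑ i, u r i • fl i r (xb r) := by
    intro s
    rcases le_total 0 s with h | h
    · rw [intervalIntegral.integral_of_le h, ← integral_Icc_eq_integral_Ioc]
      exact (hode 0 s h).2
    · rw [intervalIntegral.integral_symm, intervalIntegral.integral_of_le h, ← integral_Icc_eq_integral_Ioc,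
        (hode s 0 h).2]
      abel
  have hloc : LocallyIntegrable (fun s => ∑ i, u s i • fl i s (xb s)) volume := by
    rw [locallyIntegrable_iff]
    intro A hA
    obtain ⟨r, hr⟩ := hA.isBounded.subset_closedBall 0
    rw [Real.closedBall_eq_Icc] at hr
    by_cases hr0 : 0 ≤ r
    · exact (hode (0 - r) (0 + r) (by linarith)).1.mono_set hr
    · rw [Icc_eq_empty (by linarith)] at hr
      rw [subset_empty_iff.1 hr]; simp
  have hder := _root_.LocallyIntegrable.ae_hasDerivAt_integral hloc
  have hcomplete : CompleteTrajOf 𝒯 χ fl hl xb u := by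
    refine ⟨fun s => hKX (W.xK s), ⟨_, hii, hxint⟩, ⟨hu, _, _, W.htt, W.hT, hv⟩, ?_⟩
    filter_upwards [W.uset χ hχ_closed hinv u hu hv, hder,
      W.eta η hη_nonneg hη_meas hη_bdd hη_contu hl hhlW hzW u hu hv] with s hs1 hs2 hs3
    refine ⟨hs1, ?_, hs3⟩
    have := (hs2 0).const_add (xb 0)
    refine this.congr_of_eventuallyEq (Eventually.of_forall fun r => hxint r)
  have hinf := hred _ W.htt fl hl hflW hhlW xb u ⟨K, hK, hKX, W.xK⟩ hcomplete
  have : δ ≤ ⨅ s : ℝ, ‖xb s‖ := le_ciInf W.xδ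
  linarith

end SwAux
end

open SwitchedSys Filter Set MeasureTheory Topology
section
namespace SwAux
variable {n N : ℕ} {𝒳 : Set (E n)} {f : ℝ → E n → Fin N → E n}

lemma stab_local (𝒯 : Set (Sol 𝒳 f)) (χ : Fin N → Set (E n)) (hinv : InvariantWrt 𝒯 χ)
    (V : ℝ → E n → Fin N → ℝ) (φ₁ φ₂ : ℝ → ℝ) (hφ₁ : ClassK φ₁) (hφ₂ : ClassK φ₂)
    (hsandwich : ∀ i : Fin N, ∀ t : ℝ, 0 ≤ t → ∀ ξ ∈ χ i ∩ 𝒳,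
      φ₁ ‖ξ‖ ≤ V t ξ i ∧ V t ξ i ≤ φ₂ ‖ξ‖)
    (hV_mono : ∀ T ∈ 𝒯, ∀ t s : ℝ, T.InDom t → t < s → (s : EReal) < T.tf →
      T.σ t = T.σ s → V s (T.x s) (T.σ t) ≤ V t (T.x t) (T.σ t))
    (ρ : ℝ) (hρ : 0 < ρ) : ∃ δ > 0, ∀ T ∈ 𝒯, ∀ s, T.t0 ≤ s → ‖T.x s‖ ≤ δ →
      ∀ t, s ≤ t → (t : EReal) < T.tf → ‖T.x t‖ ≤ ρ := by
  have key : ∀ a : ℝ, ∃ b, 0 < a → 0 < b ∧ b ≤ a ∧ φ₂ b ≤ φ₁ a := by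
    intro a
    by_cases ha : 0 < a
    · have h1 : 0 < φ₁ a := by
        have := hφ₁.2.1 (show (0:ℝ) ∈ Ici 0 by simp) (show a ∈ Ici 0 from ha.le) ha
        rwa [hφ₁.2.2] at this
      have h2 : Tendsto φ₂ (𝓝[>] 0) (𝓝 0) :=
        (classK_tendsto hφ₂).mono_left (nhdsWithin_mono _ Ioi_subset_Ici_self)
      have h3 : ∀ᶠ b in 𝓝[>] (0:ℝ), φ₂ b < φ₁ a := h2.eventually_lt_const h1
      have h4 : ∀ᶠ b in 𝓝[>] (0:ℝ), b ∈ Ioc 0 a := Ioc_mem_nhdsGT ha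
      obtain ⟨b, hb1, hb2⟩ := (h3.and h4).exists
      exact ⟨b, fun _ => ⟨hb2.1, hb2.2, hb1.le⟩⟩
    · exact ⟨0, fun h => absurd h ha⟩
  choose g hg using key
  have hpos : ∀ m : ℕ, 0 < g^[m] ρ := by
    intro m; induction m with
    | zero => simpa using hρ
    | succ m ih => rw [Function.iterate_succ_apply']; exact (hg _ ih).1
  have hanti : Antitone fun m : ℕ => g^[m] ρ := antitone_nat_of_succ_le fun m => by
    rw [Function.iterate_succ_apply']; exact (hg _ (hpos m)).2.1
  refine ⟨g^[N] ρ, hpos N, fun T hT s hs hs0 t hst ht => ?_⟩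
  have := chain_bound 𝒯 χ hinv V φ₁ φ₂ hφ₁ hφ₂ hsandwich hV_mono (fun j => g^[N - j] ρ)
    (fun j => (hpos _).le) (fun a b hab => hanti (by omega)) (fun j hj => by
      have e : N - j = (N - (j+1)) + 1 := by omega
      rw [e, Function.iterate_succ_apply']
      exact (hg _ (hpos _)).2.2) T hT s hs (by simpa using hs0) t hst ht
  simpa using this

lemma stab_global (𝒯 : Set (Sol 𝒳 f)) (χ : Fin N → Set (E n)) (hinv : InvariantWrt 𝒯 χ)
    (V : ℝ → E n → Fin N → ℝ) (φ₁ φ₂ : ℝ → ℝ) (hφ₁ : ClassK φ₁) (hφ₂ : ClassK φ₂)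
    (hsandwich : ∀ i : Fin N, ∀ t : ℝ, 0 ≤ t → ∀ ξ ∈ χ i ∩ 𝒳,
      φ₁ ‖ξ‖ ≤ V t ξ i ∧ V t ξ i ≤ φ₂ ‖ξ‖)
    (hV_mono : ∀ T ∈ 𝒯, ∀ t s : ℝ, T.InDom t → t < s → (s : EReal) < T.tf →
      T.σ t = T.σ s → V s (T.x s) (T.σ t) ≤ V t (T.x t) (T.σ t))
    (hinf : Tendsto φ₁ atTop atTop)
    (R : ℝ) : ∃ M, ∀ T ∈ 𝒯, ∀ s, T.t0 ≤ s → ‖T.x s‖ ≤ R →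
      ∀ t, s ≤ t → (t : EReal) < T.tf → ‖T.x t‖ ≤ M := by
  have key : ∀ a : ℝ, ∃ b, a ≤ b ∧ φ₂ a ≤ φ₁ b := fun a =>
    ((eventually_ge_atTop a).and (hinf.eventually_ge_atTop (φ₂ a))).exists
  choose g hg using key
  have hmono : Monotone fun m : ℕ => g^[m] (max R 0) := monotone_nat_of_le_succ fun m => by
    rw [Function.iterate_succ_apply']; exact (hg _).1
  refine ⟨g^[N] (max R 0), fun T hT s hs hs0 t hst ht => ?_⟩
  exact chain_bound 𝒯 χ hinv V φ₁ φ₂ hφ₁ hφ₂ hsandwich hV_mono (fun j => g^[j] (max R 0))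
    (fun j => (le_max_right R 0).trans (hmono (Nat.zero_le j))) hmono (fun j hj => by
      rw [Function.iterate_succ_apply']
      exact (hg _).2) T hT s hs (hs0.trans (le_max_left R 0)) t hst ht

lemma KL_of (𝒯 : Set (Sol 𝒳 f)) (P : ℝ → Prop)
    (hst : ∀ ρ > 0, ∃ δ > 0, ∀ T ∈ 𝒯, ∀ s, T.t0 ≤ s → ‖T.x s‖ ≤ δ →
      ∀ t, s ≤ t → (t : EReal) < T.tf → ‖T.x t‖ ≤ ρ)
    (hb : ∀ R, ∃ M, Metric.closedBall (0 : E n) M ⊆ 𝒳 ∧ ∀ T ∈ 𝒯, ∀ s, T.t0 ≤ s → P ‖T.x s‖ →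
      ‖T.x s‖ ≤ R → ∀ t, s ≤ t → (t : EReal) < T.tf → ‖T.x t‖ ≤ M)
    (hattr : ∀ K : Set (E n), IsCompact K → K ⊆ 𝒳 → ∀ δ : ℝ, 0 < δ →
      ∃ L, 0 < L ∧ ∀ T ∈ 𝒯, ∀ s, T.t0 ≤ s → ((s+L:ℝ):EReal) < T.tf →
        ¬ ∀ τ ∈ Icc s (s+L), T.x τ ∈ K ∧ δ ≤ ‖T.x τ‖) :
    ∃ β : ℝ → ℝ → ℝ, ClassKL β ∧ ∀ T ∈ 𝒯, ∀ s : ℝ, T.InDom s → P ‖T.x s‖ →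
      ∀ t : ℝ, s ≤ t → (t : EReal) < T.tf → ‖T.x t‖ ≤ β ‖T.x s‖ (t - s) := by
  let S : Set (ℝ × ℝ × ℝ) := {p | ∃ T ∈ 𝒯, ∃ s t : ℝ, T.t0 ≤ s ∧ P ‖T.x s‖ ∧ s ≤ t ∧
      (t : EReal) < T.tf ∧ p = (‖T.x s‖, t - s, ‖T.x t‖)}
  have hE : ∃ β, ClassKL β ∧ ∀ p ∈ S, p.2.2 ≤ β p.1 p.2.1 := by
    refine exists_KL S ?_ ?_ ?_ ?_
    · rintro _ ⟨T, hT, s, t, hs, hP, h1, h2, rfl⟩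
      exact ⟨norm_nonneg _, sub_nonneg.2 h1, norm_nonneg _⟩
    · intro ε hε
      obtain ⟨δ, hδ, h⟩ := hst ε hε
      refine ⟨δ, hδ, ?_⟩
      rintro _ ⟨T, hT, s, t, hs, hP, h1, h2, rfl⟩ hle
      exact h T hT s hs hle t h1 h2
    · intro R
      obtain ⟨M, -, h⟩ := hb R
      refine ⟨M, ?_⟩
      rintro _ ⟨T, hT, s, t, hs, hP, h1, h2, rfl⟩ hle
      exact h T hT s hs hP hle t h1 h2
    · intro R ε hε
      obtain ⟨M, hMX, hM⟩ := hb R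
      obtain ⟨δ, hδ, hδε⟩ := hst ε hε
      obtain ⟨L, hL, hLL⟩ := hattr _ (isCompact_closedBall (0 : E n) M) hMX δ hδ
      refine ⟨L, ?_⟩
      rintro _ ⟨T, hT, s, t, hs, hP, h1, h2, rfl⟩ hle hLt
      simp only at hle hLt ⊢
      have hsL : s + L ≤ t := by linarith
      have h3 := hLL T hT s hs (lt_tf_of_le hsL h2)
      push Not at h3
      obtain ⟨τ, hτ, hτ2⟩ := h3
      have h4 : ‖T.x τ‖ < δ := hτ2 (by
        rw [mem_closedBall_zero_iff]
        exact hM T hT s hs hP hle τ hτ.1 (lt_tf_of_le (hτ.2.trans hsL) h2))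
      exact hδε T hT τ (hs.trans hτ.1) h4.le t (hτ.2.trans hsL) h2
  obtain ⟨β, hβ, hle⟩ := hE
  refine ⟨β, hβ, fun T hT s hs hP t hst ht => ?_⟩
  exact hle (‖T.x s‖, t - s, ‖T.x t‖) ⟨T, hT, s, t, hs.1, hP, hst, ht, rfl⟩

end SwAux
end

/-- Theorem 5 (an extension of the Krasovskii–LaSalle theorem): if 𝒯 is invariant
w.r.t. a closed covering χ, admits multiple weak Lyapunov functions (Assumption 6)
with output h(t,ξ,i) = η_i(t,ξ) satisfying Assumptions 2 and 3, and every reduced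
limiting control system Σ_γ for 𝒯 is WZSD, then 𝒯 is UAS; if in addition 𝒳 = ℝⁿ and
φ₁, φ₂ ∈ 𝒦∞, then 𝒯 is GUAS. -/
theorem uas_of_weak_lyapunov_and_reduced_wzsd
    {n N : ℕ} (𝒳 : Set (E n)) (hXopen : IsOpen 𝒳) (hX0 : (0 : E n) ∈ 𝒳)
    (f fhat Δf : ℝ → E n → Fin N → E n)
    (hdecomp : ∀ t ξ i, f t ξ i = fhat t ξ i + Δf t ξ i)
    (hf_car : ∀ i, Caratheodory 𝒳 fun t ξ => f t ξ i)
    (𝒯 : Set (Sol 𝒳 f)) (hmax : ∀ T ∈ 𝒯, T.IsMaximal)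
    (χ : Fin N → Set (E n)) (hχ_closed : ∀ i, IsClosed (χ i))
    (hχ_cover : (⋃ i, χ i) = Set.univ) (hinv : InvariantWrt 𝒯 χ)
    -- Assumption 6: multiple weak Lyapunov functions
    (V : ℝ → E n → Fin N → ℝ) (hV_nonneg : ∀ t ξ i, 0 ≤ V t ξ i)
    (φ₁ φ₂ : ℝ → ℝ) (hφ₁ : ClassK φ₁) (hφ₂ : ClassK φ₂)
    (hsandwich : ∀ i : Fin N, ∀ t : ℝ, 0 ≤ t → ∀ ξ ∈ χ i ∩ 𝒳,
      φ₁ ‖ξ‖ ≤ V t ξ i ∧ V t ξ i ≤ φ₂ ‖ξ‖)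
    (hV_smooth : ∀ i : Fin N,
      ContDiffOn ℝ 1 (fun q : ℝ × E n => V q.1 q.2 i) (Ici (0:ℝ) ×ˢ 𝒳))
    (η : Fin N → ℝ → E n → ℝ) (hη_nonneg : ∀ i t ξ, 0 ≤ η i t ξ)
    (hη_meas : ∀ i ξ, Measurable fun t => η i t ξ)
    (hη_cont : ∀ i, ∀ᵐ t ∂(volume.restrict (Ici (0:ℝ))), ContinuousOn (η i t) 𝒳)
    (hV_decrease : ∀ i : Fin N, ∀ t : ℝ, 0 ≤ t → ∀ ξ ∈ χ i ∩ 𝒳,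
      ∀ D : ℝ × E n →L[ℝ] ℝ,
        HasFDerivWithinAt (fun q : ℝ × E n => V q.1 q.2 i) D (Ici (0:ℝ) ×ˢ 𝒳) (t, ξ) →
        D (1, f t ξ i) ≤ -(η i t ξ))
    (hV_mono : ∀ T ∈ 𝒯, ∀ t s : ℝ, T.InDom t → t < s → (s : EReal) < T.tf →
      T.σ t = T.σ s → V s (T.x s) (T.σ t) ≤ V t (T.x t) (T.σ t))
    -- Assumptions 2 and 3 for f and the output h(t,ξ,i) = η_i(t,ξ)
    (hf_bdd : ∀ i, UnifBounded 𝒳 fun t ξ => f t ξ i)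
    (hη_bdd : ∀ i, UnifBounded 𝒳 (η i))
    (hη_contu : ∀ i, ContXiUnifT 𝒳 (η i))
    (hη_pre : ∀ i, Precompact 𝒳 (η i))
    (hfhat_bdd : ∀ i, UnifBounded 𝒳 fun t ξ => fhat t ξ i)
    (hfhat_meas : ∀ i, ∀ ξ ∈ 𝒳, Measurable fun t => fhat t ξ i)
    (hfhat_cont : ∀ i, ContXiUnifT 𝒳 fun t ξ => fhat t ξ i)
    (hfhat_pre : ∀ i, Precompact 𝒳 fun t ξ => fhat t ξ i)
    (hzp : ∀ i, ZeroingPair 𝒳 (η i) fun t ξ => Δf t ξ i)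
    -- every reduced limiting control system Σ_γ for 𝒯 is WZSD
    (hred : ∀ γ : ℕ → ℝ, Tendsto γ atTop atTop →
      ∀ (fl : Fin N → ℝ → E n → E n) (hlm : Fin N → ℝ → E n → ℝ),
        (∀ i, IsLimitAlong 𝒳 (fun t ξ => fhat t ξ i) γ (fl i)) →
        (∀ i, IsLimitAlong 𝒳 (η i) γ (hlm i)) →
        ∀ (x : ℝ → E n) (u : ℝ → Fin N → ℝ),
          BoundedRange 𝒳 x →
          CompleteTrajOf 𝒯 χ fl hlm x u →
          (⨅ t : ℝ, ‖x t‖) = 0) :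
    UAS 𝒯 ∧ (𝒳 = Set.univ → ClassKInf φ₁ → ClassKInf φ₂ → GUAS 𝒯) := by
  have hW := SwAux.wzsd fhat Δf hdecomp 𝒯 χ hχ_closed hinv η hη_nonneg hη_meas hf_bdd hη_bdd
    hη_contu hη_pre hfhat_bdd hfhat_meas hfhat_cont hfhat_pre hzp hred
  have hst := SwAux.stab_local 𝒯 χ hinv V φ₁ φ₂ hφ₁ hφ₂ hsandwich hV_mono
  have hattr := SwAux.attr hXopen 𝒯 χ hinv V hV_nonneg φ₁ φ₂ hφ₂ hsandwich hV_smooth η hη_nonneg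
    hη_meas hη_cont hV_decrease hV_mono hf_bdd hη_bdd hW
  constructor
  · obtain ⟨R, hR, hRX⟩ := Metric.nhds_basis_closedBall.mem_iff.1 (hXopen.mem_nhds hX0)
    obtain ⟨δ₀, hδ₀, hδR⟩ := hst R hR
    obtain ⟨β, hβ, h⟩ := SwAux.KL_of 𝒯 (fun r => r < δ₀) hst
      (fun _ => ⟨R, hRX, fun T hT s hs hP _ t h1 h2 => hδR T hT s hs hP.le t h1 h2⟩) hattr
    exact ⟨β, δ₀, hβ, hδ₀, h⟩
  · intro hX h1 _
    obtain ⟨β, hβ, h⟩ := SwAux.KL_of 𝒯 (fun _ => True) hst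
      (fun R => by
        obtain ⟨M, hM⟩ := SwAux.stab_global 𝒯 χ hinv V φ₁ φ₂ hφ₁ hφ₂ hsandwich hV_mono h1.2 R
        exact ⟨M, by rw [hX]; exact Set.subset_univ _, fun T hT s hs _ => hM T hT s hs⟩) hattr
    exact ⟨hX, β, hβ, fun T hT s hs => h T hT s hs trivial⟩
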